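/- Let Γ be a discrete abelian group and A, B ⊆ Γ nonempty. Then there exists a finite-index subgroup K ≤ Γ such that whenever ν and η are extreme invariant means on ℓ^∞(Γ) satisfying max{ν(A+B), η(A+B)} < ν(A) + η(B), one has: ν((A+B) Δ (A+B+K)) = 0 and η((A+B) Δ (A+B+K)) = 0; K = H(A+B+K), i.e. K is the stabilizer of A+B+K; and ν(A+B+K) = ν(A+K) + ν(B+K) − ν(K). Moreover, if there exists at least one pair of extreme invariant means ν, η with max{ν(A+B), η(A+B)} < ν(A) + η(B), then K is the unique finite-index subgroup of Γ with this property. -/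

import Mathlib

open scoped Pointwise
open Filter

namespace SumsetMeans

variable (Γ : Type*) [AddCommGroup Γ] [TopologicalSpace Γ] [DiscreteTopology Γ]

/-- The indicator function of `A ⊆ Γ` as a bounded (continuous, since `Γ` is discrete)
real-valued function, i.e. as an element of `ℓ^∞(Γ)`. -/
noncomputable def ind (A : Set Γ) : BoundedContinuousFunction Γ ℝ :=
  BoundedContinuousFunction.ofNormedAddCommGroup (Set.indicator A 1)
    continuous_of_discreteTopology 1
    (fun x => by by_cases h : x ∈ A <;> simp [Set.indicator_apply, h])

/-- The translate `τ_γ f`, given by `(τ_γ f)(x) = f (x - γ)`. -/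
noncomputable def translate (γ : Γ) (f : BoundedContinuousFunction Γ ℝ) :
    BoundedContinuousFunction Γ ℝ :=
  f.compContinuous ⟨fun x => x - γ, continuous_of_discreteTopology⟩

/-- An invariant mean on `ℓ^∞(Γ)`: a linear functional with `m 1 = 1`, nonnegative on
nonnegative functions, and invariant under all translations. -/
structure IsInvariantMean (m : BoundedContinuousFunction Γ ℝ →ₗ[ℝ] ℝ) : Prop where
  map_one : m 1 = 1
  nonneg : ∀ f : BoundedContinuousFunction Γ ℝ, (∀ x, 0 ≤ f x) → 0 ≤ m f
  invariant : ∀ (γ : Γ) (f : BoundedContinuousFunction Γ ℝ), m (translate Γ γ f) = m f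

/-- The value `m(A) := m(1_A)` of a mean on a set `A ⊆ Γ`. -/
noncomputable def mVal (m : BoundedContinuousFunction Γ ℝ →ₗ[ℝ] ℝ) (A : Set Γ) : ℝ :=
  m (ind Γ A)

/-- Upper Banach density: `d*(A) = sup { m(A) : m an invariant mean on ℓ^∞(Γ) }`. -/
noncomputable def ubd (A : Set Γ) : ℝ :=
  sSup {x : ℝ | ∃ m, IsInvariantMean Γ m ∧ mVal Γ m A = x}

/-- An extreme invariant mean: an extreme point of the convex set of invariant means. -/
def IsExtremeInvariantMean (ν : BoundedContinuousFunction Γ ℝ →ₗ[ℝ] ℝ) : Prop :=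
  ν ∈ Set.extremePoints ℝ {m : BoundedContinuousFunction Γ ℝ →ₗ[ℝ] ℝ | IsInvariantMean Γ m}

/-- The property of `K` asserted in the two-means theorem: `K` has finite index, and for all
extreme invariant means `ν`, `η` with `max{ν(A+B), η(A+B)} < ν(A) + η(B)` one has
`A+B ∼_{ν,η} A+B+K`, `K` is the stabilizer of `A+B+K`, and the Kneser equation holds. -/
def TwoMeansProp (A B : Set Γ) (K : AddSubgroup Γ) : Prop :=
  K.FiniteIndex ∧
  ∀ ν η : BoundedContinuousFunction Γ ℝ →ₗ[ℝ] ℝ,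
    IsExtremeInvariantMean Γ ν → IsExtremeInvariantMean Γ η →
    max (mVal Γ ν (A + B)) (mVal Γ η (A + B)) < mVal Γ ν A + mVal Γ η B →
      mVal Γ ν (symmDiff (A + B) (A + B + (K : Set Γ))) = 0 ∧
      mVal Γ η (symmDiff (A + B) (A + B + (K : Set Γ))) = 0 ∧
      (K : Set Γ) = {γ : Γ | A + B + (K : Set Γ) + {γ} = A + B + (K : Set Γ)} ∧
      mVal Γ ν (A + B + (K : Set Γ)) =
        mVal Γ ν (A + (K : Set Γ)) + mVal Γ ν (B + (K : Set Γ)) - mVal Γ ν (K : Set Γ)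

namespace IsInvariantMean

variable {Γ} {m : BoundedContinuousFunction Γ ℝ →ₗ[ℝ] ℝ}

lemma mono (hm : IsInvariantMean Γ m) {f g : BoundedContinuousFunction Γ ℝ}
    (h : ∀ x, f x ≤ g x) : m f ≤ m g := by
  have := hm.nonneg (g - f) fun x => by simpa using h x
  rw [map_sub] at this
  linarith

lemma abs_le (hm : IsInvariantMean Γ m) (f : BoundedContinuousFunction Γ ℝ) {c : ℝ}
    (h : ∀ x, |f x| ≤ c) : |m f| ≤ c := by
  have h1 : m (c • (1 : BoundedContinuousFunction Γ ℝ)) = c := by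
    rw [map_smul, hm.map_one]; simp
  have h2 : m f ≤ m (c • (1 : BoundedContinuousFunction Γ ℝ)) :=
    hm.mono fun x => by simpa using (_root_.abs_le.1 (h x)).2
  have h3 : m ((-c) • (1 : BoundedContinuousFunction Γ ℝ)) ≤ m f :=
    hm.mono fun x => by simpa using (_root_.abs_le.1 (h x)).1
  have h4 : m ((-c) • (1 : BoundedContinuousFunction Γ ℝ)) = -c := by
    rw [map_smul, hm.map_one]; simp
  rw [_root_.abs_le]
  constructor <;> linarith

end IsInvariantMean

section Means

variable {Γ}

lemma ind_apply (A : Set Γ) (x : Γ) : ind Γ A x = A.indicator (fun _ => (1 : ℝ)) x := rfl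

lemma translate_apply (γ : Γ) (f : BoundedContinuousFunction Γ ℝ) (x : Γ) :
    translate Γ γ f x = f (x - γ) := rfl

lemma abs_mul_translate_ind_le (f : BoundedContinuousFunction Γ ℝ) (Z : Set Γ) (y x : Γ) :
    |(f * translate Γ (-y) (ind Γ Z)) x| ≤ ‖f‖ := by
  have h := f.norm_coe_le_norm x
  rw [Real.norm_eq_abs] at h
  by_cases hx : x + y ∈ Z
  · simpa [translate_apply, ind_apply, hx] using h
  · simp [translate_apply, ind_apply, hx]

/-- The function `y ↦ m (f · 1_{Z - y})`. -/
noncomputable def correlation {m : BoundedContinuousFunction Γ ℝ →ₗ[ℝ] ℝ}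
    (hm : IsInvariantMean Γ m) (Z : Set Γ) (f : BoundedContinuousFunction Γ ℝ) :
    BoundedContinuousFunction Γ ℝ :=
  BoundedContinuousFunction.ofNormedAddCommGroup
    (fun y => m (f * translate Γ (-y) (ind Γ Z))) continuous_of_discreteTopology ‖f‖
    (fun y => hm.abs_le _ (abs_mul_translate_ind_le f Z y))

lemma correlation_apply {m : BoundedContinuousFunction Γ ℝ →ₗ[ℝ] ℝ}
    (hm : IsInvariantMean Γ m) (Z : Set Γ) (f : BoundedContinuousFunction Γ ℝ) (y : Γ) :
    correlation hm Z f y = m (f * translate Γ (-y) (ind Γ Z)) := rfl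

/-- The functional `f ↦ η_y (ν (f · 1_{Z - y}))`. -/
noncomputable def averagedRestriction {ν : BoundedContinuousFunction Γ ℝ →ₗ[ℝ] ℝ}
    (hν : IsInvariantMean Γ ν) (η : BoundedContinuousFunction Γ ℝ →ₗ[ℝ] ℝ) (Z : Set Γ) :
    BoundedContinuousFunction Γ ℝ →ₗ[ℝ] ℝ where
  toFun f := η (correlation hν Z f)
  map_add' f g := by
    rw [← map_add]
    congr 1
    ext y
    simp [correlation_apply, add_mul]
  map_smul' c f := by
    rw [RingHom.id_apply, ← map_smul]
    congr 1
    ext y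
    simp [correlation_apply, smul_mul_assoc]

variable {ν η : BoundedContinuousFunction Γ ℝ →ₗ[ℝ] ℝ}

lemma averagedRestriction_apply (hν : IsInvariantMean Γ ν) (Z : Set Γ)
    (f : BoundedContinuousFunction Γ ℝ) :
    averagedRestriction hν η Z f = η (correlation hν Z f) := rfl

lemma averagedRestriction_nonneg (hν : IsInvariantMean Γ ν) (hη : IsInvariantMean Γ η)
    (Z : Set Γ) (f : BoundedContinuousFunction Γ ℝ) (hf : ∀ x, 0 ≤ f x) :
    0 ≤ averagedRestriction hν η Z f := by
  refine hη.nonneg _ fun y => hν.nonneg _ fun x => ?_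
  exact mul_nonneg (hf x) (Set.indicator_nonneg (fun _ _ => zero_le_one) _)

lemma averagedRestriction_le (hν : IsInvariantMean Γ ν) (hη : IsInvariantMean Γ η)
    (Z : Set Γ) (f : BoundedContinuousFunction Γ ℝ) (hf : ∀ x, 0 ≤ f x) :
    averagedRestriction hν η Z f ≤ ν f := by
  have h1 : ν f = η (ν f • (1 : BoundedContinuousFunction Γ ℝ)) := by
    rw [map_smul, hη.map_one]; simp
  rw [h1]
  refine hη.mono fun y => ?_
  have h2 : ν (f * translate Γ (-y) (ind Γ Z)) ≤ ν f := by
    refine hν.mono fun x => ?_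
    exact mul_le_of_le_one_right (hf x)
      (Set.indicator_le_self' (fun _ _ => zero_le_one) _)
  simpa [correlation_apply] using h2

lemma averagedRestriction_one (hν : IsInvariantMean Γ ν) (hη : IsInvariantMean Γ η)
    (Z : Set Γ) : averagedRestriction hν η Z 1 = mVal Γ ν Z := by
  have h1 : correlation hν Z 1 = mVal Γ ν Z • (1 : BoundedContinuousFunction Γ ℝ) := by
    ext y
    simp [correlation_apply, hν.invariant, mVal]
  rw [averagedRestriction_apply, h1, map_smul, hη.map_one]
  simp

lemma averagedRestriction_translate (hν : IsInvariantMean Γ ν) (hη : IsInvariantMean Γ η)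
    (Z : Set Γ) (s : Γ) (f : BoundedContinuousFunction Γ ℝ) :
    averagedRestriction hν η Z (translate Γ s f) = averagedRestriction hν η Z f := by
  have h1 : correlation hν Z (translate Γ s f) = translate Γ (-s) (correlation hν Z f) := by
    ext y
    rw [translate_apply, correlation_apply, correlation_apply, ← hν.invariant s (f * _)]
    congr 1
    ext x
    simp only [BoundedContinuousFunction.mul_apply, translate_apply]
    congr 2
    abel
  rw [averagedRestriction_apply, h1, hη.invariant, averagedRestriction_apply]

/-- Ergodicity of extreme invariant means. -/
lemma averagedRestriction_eq (hν : IsExtremeInvariantMean Γ ν) (hη : IsInvariantMean Γ η)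
    (Z : Set Γ) (f : BoundedContinuousFunction Γ ℝ) :
    averagedRestriction hν.1 η Z f = mVal Γ ν Z * ν f := by
  have hν' : IsInvariantMean Γ ν := hν.1
  set z := mVal Γ ν Z with hz
  set l := averagedRestriction hν' η Z with hl
  have hl1 : l 1 = z := averagedRestriction_one hν' hη Z
  have hl0 : ∀ f : BoundedContinuousFunction Γ ℝ, (∀ x, 0 ≤ f x) → 0 ≤ l f :=
    averagedRestriction_nonneg hν' hη Z
  have hle : ∀ f : BoundedContinuousFunction Γ ℝ, (∀ x, 0 ≤ f x) → l f ≤ ν f :=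
    averagedRestriction_le hν' hη Z
  have hz0 : 0 ≤ z := by rw [← hl1]; exact hl0 1 fun x => by simp
  have hz1 : z ≤ 1 := by rw [← hl1, ← hν'.map_one]; exact hle 1 fun x => by simp
  have key : ∀ (k : BoundedContinuousFunction Γ ℝ →ₗ[ℝ] ℝ),
      (∀ f : BoundedContinuousFunction Γ ℝ, (∀ x, 0 ≤ f x) → 0 ≤ k f) → k 1 = 0 →
      ∀ f, k f = 0 := by
    intro k hk hk1 f
    have h1 := hk (‖f‖ • 1 - f) fun x => by
      simpa using (le_abs_self _).trans (f.norm_coe_le_norm x)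
    have h2 := hk (‖f‖ • 1 + f) fun x => by
      have := neg_le_of_abs_le (f.norm_coe_le_norm x)
      simp; linarith
    rw [map_sub, map_smul, hk1] at h1
    rw [map_add, map_smul, hk1] at h2
    simp at h1 h2
    linarith
  rcases hz0.eq_or_lt with h0 | h0
  · rw [← h0, zero_mul]
    exact key l hl0 (hl1.trans h0.symm) f
  rcases hz1.eq_or_lt with h1 | h1
  · have := key (ν - l) (fun f hf => by simpa using hle f hf)
      (by simp [hl1, hν'.map_one, h1]) f
    rw [h1, one_mul]
    simp at this
    linarith
  · have hm1 : IsInvariantMean Γ (z⁻¹ • l) :=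
      ⟨by simp [hl1, h0.ne'], fun f hf => by
        simpa using mul_nonneg (inv_nonneg.2 hz0) (hl0 f hf), fun g f => by
        simp [hl, averagedRestriction_translate hν' hη]⟩
    have hz' : 0 < 1 - z := by linarith
    have hm2 : IsInvariantMean Γ ((1 - z)⁻¹ • (ν - l)) :=
      ⟨by simp [hl1, hν'.map_one, hz'.ne'], fun f hf => by
        simpa using mul_nonneg (inv_nonneg.2 hz'.le) (sub_nonneg.2 (hle f hf)), fun g f => by
        simp [hl, averagedRestriction_translate hν' hη, hν'.invariant]⟩
    have := (mem_extremePoints.1 hν).2 _ hm1 _ hm2 ⟨z, 1 - z, h0, hz', by ring, by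
      rw [smul_smul, smul_smul, mul_inv_cancel₀ h0.ne', mul_inv_cancel₀ hz'.ne']
      simp⟩
    have h3 := congrArg (fun k => k f) this.1
    simp only [LinearMap.smul_apply, smul_eq_mul] at h3
    rw [← h3]
    field_simp

end Means

section Content

variable {G : Type*} [AddCommGroup G]

/-- The translate `S + g`. -/
def shift (g : G) (S : Set G) : Set G := {x | x - g ∈ S}

lemma mem_shift {g x : G} {S : Set G} : x ∈ shift g S ↔ x - g ∈ S := Iff.rfl

lemma mem_shift_neg {g x : G} {S : Set G} : x ∈ shift (-g) S ↔ x + g ∈ S := by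
  rw [mem_shift, sub_neg_eq_add]

lemma shift_shift (g h : G) (S : Set G) : shift g (shift h S) = shift (g + h) S := by
  ext x
  simp only [mem_shift]
  rw [show x - g - h = x - (g + h) by abel]

lemma shift_zero (S : Set G) : shift 0 S = S := by
  ext x
  simp [mem_shift]

/-- A translation-invariant finitely additive probability on all subsets of `G`. -/
structure IsContent (μ : Set G → ℝ) : Prop where
  univ : μ Set.univ = 1
  nonneg : ∀ S, 0 ≤ μ S
  union : ∀ S T, Disjoint S T → μ (S ∪ T) = μ S + μ T
  map_shift : ∀ g S, μ (shift g S) = μ S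

/-- Ergodic averaging: the mean over `y` with respect to `η` of `ν (E ∩ (Z - y))` is
`ν E * ν Z`. -/
structure Mixes (ν η : Set G → ℝ) : Prop where
  lower : ∀ (E Z Y : Set G) (c : ℝ), 0 ≤ c →
    (∀ y ∈ Y, c ≤ ν (E ∩ shift (-y) Z)) → η Y * c ≤ ν E * ν Z
  upper : ∀ (E Z W : Set G) (c : ℝ), 0 ≤ c → (∀ y ∈ W, ν (E ∩ shift (-y) Z) ≤ c) →
    (∀ y ∉ W, ν (E ∩ shift (-y) Z) = 0) → ν E * ν Z ≤ c * η W

namespace IsContent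

variable {μ ν η : Set G → ℝ}

lemma empty (hμ : IsContent μ) : μ ∅ = 0 := by
  have := hμ.union ∅ ∅ (by simp)
  simp at this
  exact this

lemma diff_add_inter (hμ : IsContent μ) (S T : Set G) : μ (S \ T) + μ (S ∩ T) = μ S := by
  rw [← hμ.union _ _ (Set.disjoint_left.2 fun x h1 h2 => h1.2 h2.2), Set.sdiff_union_inter]

lemma mono (hμ : IsContent μ) {S T : Set G} (h : S ⊆ T) : μ S ≤ μ T := by
  have h1 := hμ.diff_add_inter T S
  rw [Set.inter_eq_right.2 h] at h1
  linarith [hμ.nonneg (T \ S)]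

lemma le_one (hμ : IsContent μ) (S : Set G) : μ S ≤ 1 := by
  rw [← hμ.univ]
  exact hμ.mono (Set.subset_univ S)

lemma union_eq (hμ : IsContent μ) (S T : Set G) : μ (S ∪ T) = μ S + μ (T \ S) := by
  rw [← hμ.union _ _ Set.disjoint_sdiff_right, Set.union_sdiff_self]

lemma union_add_inter (hμ : IsContent μ) (S T : Set G) :
    μ (S ∪ T) + μ (S ∩ T) = μ S + μ T := by
  rw [hμ.union_eq, Set.inter_comm S T]
  linarith [hμ.diff_add_inter T S]

lemma union_le (hμ : IsContent μ) (S T : Set G) : μ (S ∪ T) ≤ μ S + μ T := by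
  linarith [hμ.union_add_inter S T, hμ.nonneg (S ∩ T)]

lemma le_add (hμ : IsContent μ) {S T U : Set G} (h : S ⊆ T ∪ U) : μ S ≤ μ T + μ U :=
  (hμ.mono h).trans (hμ.union_le T U)

lemma null_of_subset (hμ : IsContent μ) {S T : Set G} (h : S ⊆ T) (hT : μ T = 0) : μ S = 0 :=
  le_antisymm (hT ▸ hμ.mono h) (hμ.nonneg S)

lemma null_union (hμ : IsContent μ) {S T : Set G} (hS : μ S = 0) (hT : μ T = 0) :
    μ (S ∪ T) = 0 :=
  le_antisymm (by linarith [hμ.union_le S T]) (hμ.nonneg _)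

lemma nonempty_of_pos (hμ : IsContent μ) {S : Set G} (h : 0 < μ S) : S.Nonempty := by
  rw [Set.nonempty_iff_ne_empty]
  rintro rfl
  exact h.ne' hμ.empty

lemma diff_subset (hμ : IsContent μ) {S T : Set G} (h : S ⊆ T) : μ (T \ S) = μ T - μ S := by
  have := hμ.diff_add_inter T S
  rw [Set.inter_eq_right.2 h] at this
  linarith

lemma biUnion_finset (hμ : IsContent μ) {ι : Type*} (s : Finset ι) (f : ι → Set G)
    (hf : ∀ i ∈ s, ∀ j ∈ s, i ≠ j → Disjoint (f i) (f j)) :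
    μ (⋃ i ∈ s, f i) = ∑ i ∈ s, μ (f i) := by
  classical
  induction s using Finset.induction_on with
  | empty => simp [hμ.empty]
  | insert a s ha ih =>
    rw [Finset.set_biUnion_insert, Finset.sum_insert ha, hμ.union, ih]
    · exact fun i hi j hj => hf i (Finset.mem_insert_of_mem hi) j (Finset.mem_insert_of_mem hj)
    · refine Set.disjoint_iUnion₂_right.2 fun i hi => ?_
      exact hf a (Finset.mem_insert_self a s) i (Finset.mem_insert_of_mem hi)
        (by rintro rfl; exact ha hi)

lemma sum_le_one (hμ : IsContent μ) {ι : Type*} (s : Finset ι) (f : ι → Set G)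
    (hf : ∀ i ∈ s, ∀ j ∈ s, i ≠ j → Disjoint (f i) (f j)) : ∑ i ∈ s, μ (f i) ≤ 1 := by
  rw [← hμ.biUnion_finset s f hf]
  exact hμ.le_one _

end IsContent

/-! ### Cosets and periodic sets -/

/-- The coset of `K` given by a class in `G ⧸ K`. -/
def fiber (K : AddSubgroup G) (q : G ⧸ K) : Set G := {x | (x : G ⧸ K) = q}

/-- `P` is a union of cosets of `K`. -/
def Per (K : AddSubgroup G) (P : Set G) : Prop := ∀ x ∈ P, ∀ k ∈ K, x + k ∈ P

lemma mem_fiber {K : AddSubgroup G} {q : G ⧸ K} {x : G} : x ∈ fiber K q ↔ (x : G ⧸ K) = q :=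
  Iff.rfl

lemma fiber_mk (K : AddSubgroup G) (g : G) : fiber K (g : G ⧸ K) = shift g (K : Set G) := by
  ext x
  rw [mem_fiber, mem_shift, SetLike.mem_coe, eq_comm, QuotientAddGroup.eq, neg_add_eq_sub]

lemma fiber_disjoint (K : AddSubgroup G) {q r : G ⧸ K} (h : q ≠ r) :
    Disjoint (fiber K q) (fiber K r) :=
  Set.disjoint_left.2 fun _ h1 h2 => h (h1.symm.trans h2)

lemma Per.mem_of_mk_eq {K : AddSubgroup G} {P : Set G} (hP : Per K P) {x y : G} (hx : x ∈ P)
    (h : (x : G ⧸ K) = y) : y ∈ P := by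
  rw [QuotientAddGroup.eq] at h
  simpa using hP x hx _ h

lemma Per.mono {K L : AddSubgroup G} {P : Set G} (hP : Per K P) (h : L ≤ K) : Per L P :=
  fun x hx k hk => hP x hx k (h hk)

lemma Per.union {K : AddSubgroup G} {P Q : Set G} (hP : Per K P) (hQ : Per K Q) :
    Per K (P ∪ Q) := by
  rintro x (hx | hx) k hk
  · exact Or.inl (hP x hx k hk)
  · exact Or.inr (hQ x hx k hk)

lemma Per.diff {K : AddSubgroup G} {P Q : Set G} (hP : Per K P) (hQ : Per K Q) :
    Per K (P \ Q) := by
  rintro x ⟨hx, hx'⟩ k hk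
  refine ⟨hP x hx k hk, fun h => hx' ?_⟩
  simpa using hQ _ h _ (K.neg_mem hk)

lemma Per.inter {K : AddSubgroup G} {P Q : Set G} (hP : Per K P) (hQ : Per K Q) :
    Per K (P ∩ Q) :=
  fun x hx k hk => ⟨hP x hx.1 k hk, hQ x hx.2 k hk⟩

lemma Per.shift {K : AddSubgroup G} {P : Set G} (hP : Per K P) (g : G) : Per K (shift g P) := by
  intro x hx k hk
  have := hP _ hx k hk
  rwa [mem_shift, add_sub_right_comm]

lemma per_add {K : AddSubgroup G} {P Q : Set G} (hQ : Per K Q) : Per K (P + Q) := by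
  rintro _ ⟨p, hp, q, hq, rfl⟩ k hk
  exact ⟨p, hp, q + k, hQ q hq k hk, (add_assoc _ _ _).symm⟩

lemma per_add_coe (K : AddSubgroup G) (P : Set G) : Per K (P + (K : Set G)) :=
  per_add fun _ hx _ hk => K.add_mem hx hk

lemma per_self (K : AddSubgroup G) : Per K (K : Set G) := fun _ hx _ hk => K.add_mem hx hk

lemma per_fiber (K : AddSubgroup G) (q : G ⧸ K) : Per K (fiber K q) := by
  intro x hx k hk
  rw [mem_fiber] at hx ⊢
  rw [← hx, eq_comm, QuotientAddGroup.eq]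
  simpa using hk

lemma Per.eq_biUnion {K : AddSubgroup G} [Finite (G ⧸ K)] {P : Set G} (hP : Per K P) :
    P = ⋃ q ∈ ((fun x : G => (x : G ⧸ K)) '' P).toFinite.toFinset, fiber K q := by
  ext x
  simp only [Set.Finite.mem_toFinset, Set.mem_iUnion, mem_fiber, Set.mem_image]
  constructor
  · exact fun hx => ⟨x, ⟨x, hx, rfl⟩, rfl⟩
  · rintro ⟨q, ⟨y, hy, rfl⟩, h⟩
    exact hP.mem_of_mk_eq hy h.symm

namespace IsContent

variable {μ ν η : Set G → ℝ}

lemma fiber_eq (hμ : IsContent μ) (K : AddSubgroup G) (q : G ⧸ K) :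
    μ (fiber K q) = μ (K : Set G) := by
  obtain ⟨g, rfl⟩ := QuotientAddGroup.mk_surjective q
  rw [fiber_mk, hμ.map_shift]

lemma biUnion_fiber (hμ : IsContent μ) (K : AddSubgroup G) (s : Finset (G ⧸ K)) :
    μ (⋃ q ∈ s, fiber K q) = s.card * μ (K : Set G) := by
  rw [hμ.biUnion_finset s _ fun _ _ _ _ h => fiber_disjoint K h]
  simp [hμ.fiber_eq]

lemma card_mul_le_one (hμ : IsContent μ) (K : AddSubgroup G) (s : Finset (G ⧸ K)) :
    s.card * μ (K : Set G) ≤ 1 := by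
  rw [← hμ.biUnion_fiber]
  exact hμ.le_one _

lemma finite_quotient (hμ : IsContent μ) {K : AddSubgroup G} (h : 0 < μ (K : Set G)) :
    Finite (G ⧸ K) := by
  by_contra hinf
  rw [not_finite_iff_infinite] at hinf
  obtain ⟨n, hn⟩ := exists_nat_gt (1 / μ (K : Set G))
  obtain ⟨s, hs⟩ := Infinite.exists_subset_card_eq (G ⧸ K) n
  have h1 := hμ.card_mul_le_one K s
  rw [hs] at h1
  rw [div_lt_iff₀ h] at hn
  linarith

lemma card_mul_eq_one (hμ : IsContent μ) (K : AddSubgroup G) [Finite (G ⧸ K)] :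
    (Nat.card (G ⧸ K) : ℝ) * μ (K : Set G) = 1 := by
  have := Fintype.ofFinite (G ⧸ K)
  rw [Nat.card_eq_fintype_card, ← Finset.card_univ, ← hμ.biUnion_fiber, ← hμ.univ]
  congr 1
  ext x
  simp [mem_fiber]

lemma pos_subgroup (hμ : IsContent μ) (K : AddSubgroup G) [Finite (G ⧸ K)] :
    0 < μ (K : Set G) := by
  rcases (hμ.nonneg (K : Set G)).lt_or_eq with h | h
  · exact h
  · have := hμ.card_mul_eq_one K
    rw [← h] at this
    simp at this

lemma subgroup_eq (hν : IsContent ν) (hη : IsContent η) (K : AddSubgroup G) [Finite (G ⧸ K)] :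
    ν (K : Set G) = η (K : Set G) := by
  have h : (Nat.card (G ⧸ K) : ℝ) ≠ 0 := by exact_mod_cast Nat.card_pos.ne'
  exact mul_left_cancel₀ h ((hν.card_mul_eq_one K).trans (hη.card_mul_eq_one K).symm)

lemma per_eq (hμ : IsContent μ) {K : AddSubgroup G} [Finite (G ⧸ K)] {P : Set G}
    (hP : Per K P) :
    μ P = ((fun x : G => (x : G ⧸ K)) '' P).ncard * μ (K : Set G) := by
  conv_lhs => rw [hP.eq_biUnion]
  rw [hμ.biUnion_fiber, Set.ncard_eq_toFinset_card _]

lemma per_congr (hν : IsContent ν) (hη : IsContent η) {K : AddSubgroup G} [Finite (G ⧸ K)]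
    {P : Set G} (hP : Per K P) : ν P = η P := by
  rw [hν.per_eq hP, hη.per_eq hP, hν.subgroup_eq hη]

lemma per_nonempty_le (hμ : IsContent μ) {K : AddSubgroup G} {P : Set G} (hP : Per K P)
    (hne : P.Nonempty) : μ (K : Set G) ≤ μ P := by
  obtain ⟨x, hx⟩ := hne
  rw [← hμ.fiber_eq K x]
  exact hμ.mono fun y hy => hP.mem_of_mk_eq hx hy.symm

lemma per_lt (hμ : IsContent μ) {K : AddSubgroup G} {P Q : Set G}
    (hP : Per K P) (hQ : Per K Q) (h : P ⊆ Q) (hne : ¬ Q ⊆ P) :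
    μ P + μ (K : Set G) ≤ μ Q := by
  have h1 := hμ.per_nonempty_le (hQ.diff hP) (Set.sdiff_nonempty.2 hne)
  rw [hμ.diff_subset h] at h1
  linarith

lemma sum_fiber (hμ : IsContent μ) (K : AddSubgroup G) [Fintype (G ⧸ K)] (A : Set G) :
    ∑ q : G ⧸ K, μ (A ∩ fiber K q) = μ A := by
  rw [← hμ.biUnion_finset]
  · congr 1
    ext x
    simp [mem_fiber]
  · exact fun i _ j _ h => (fiber_disjoint K h).mono Set.inter_subset_right Set.inter_subset_right

lemma null_of_fiber (hμ : IsContent μ) (K : AddSubgroup G) [Finite (G ⧸ K)] {A : Set G}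
    (h : ∀ q : G ⧸ K, μ (A ∩ fiber K q) = 0) : μ A = 0 := by
  have := Fintype.ofFinite (G ⧸ K)
  rw [← hμ.sum_fiber K]
  exact Finset.sum_eq_zero fun q _ => h q

end IsContent

end Content

section MeanContent

variable {Γ}
variable {m ν η : BoundedContinuousFunction Γ ℝ →ₗ[ℝ] ℝ}

lemma IsInvariantMean.isContent (hm : IsInvariantMean Γ m) : IsContent (mVal Γ m) where
  univ := by
    rw [← hm.map_one, mVal]
    congr 1
    ext x
    simp [ind_apply]
  nonneg S := hm.nonneg _ fun x => Set.indicator_nonneg (fun _ _ => zero_le_one) x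
  union S T h := by
    simp only [mVal]
    rw [← map_add]
    congr 1
    ext x
    rw [BoundedContinuousFunction.add_apply, ind_apply, ind_apply, ind_apply,
      Set.indicator_union_of_disjoint h]
  map_shift g S := by
    rw [mVal, mVal, ← hm.invariant g (ind Γ S)]
    congr 1

lemma IsExtremeInvariantMean.mixes (hν : IsExtremeInvariantMean Γ ν)
    (hη : IsInvariantMean Γ η) : Mixes (mVal Γ ν) (mVal Γ η) := by
  have hcorr : ∀ E Z y, correlation hν.1 Z (ind Γ E) y = mVal Γ ν (E ∩ shift (-y) Z) := by
    intro E Z y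
    rw [correlation_apply, mVal]
    congr 1
    ext x
    rw [BoundedContinuousFunction.mul_apply, translate_apply, ind_apply, ind_apply, ind_apply]
    by_cases hx : x ∈ E <;> by_cases hz : x + y ∈ Z <;> simp [hx, hz, mem_shift]
  have heq : ∀ E Z, η (correlation hν.1 Z (ind Γ E)) = mVal Γ ν E * mVal Γ ν Z := by
    intro E Z
    rw [mul_comm]
    exact averagedRestriction_eq hν hη Z (ind Γ E)
  refine ⟨fun E Z Y c hc h => ?_, fun E Z W c hc h h' => ?_⟩
  · rw [← heq, mul_comm, mVal, ← smul_eq_mul, ← map_smul]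
    refine hη.mono fun y => ?_
    rw [hcorr]
    by_cases hy : y ∈ Y
    · simpa [ind_apply, hy] using h y hy
    · simpa [ind_apply, hy] using hν.1.isContent.nonneg _
  · rw [← heq, mVal, ← smul_eq_mul, ← map_smul]
    refine hη.mono fun y => ?_
    rw [hcorr]
    by_cases hy : y ∈ W
    · simpa [ind_apply, hy] using h y hy
    · simp [ind_apply, hy, h' y hy]

end MeanContent

section Kneser

variable {G : Type*} [AddCommGroup G]

/-- The number of cosets of `K` meeting `S`. -/
noncomputable def cosetCount (K : AddSubgroup G) (S : Set G) : ℕ :=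
  ((fun x : G => (x : G ⧸ K)) '' S).ncard

lemma IsContent.per_eq_cosetCount {μ : Set G → ℝ} (hμ : IsContent μ) {K : AddSubgroup G}
    [Finite (G ⧸ K)] {P : Set G} (hP : Per K P) : μ P = cosetCount K P * μ (K : Set G) :=
  hμ.per_eq hP

lemma cosetCount_union {K : AddSubgroup G} [Finite (G ⧸ K)] {P Q : Set G} (hP : Per K P)
    (h : Disjoint P Q) : cosetCount K (P ∪ Q) = cosetCount K P + cosetCount K Q := by
  rw [cosetCount, Set.image_union, Set.ncard_union_eq _ (Set.toFinite _) (Set.toFinite _)]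
  · rfl
  · refine Set.disjoint_left.2 ?_
    rintro _ ⟨x, hx, rfl⟩ ⟨y, hy, hxy⟩
    exact Set.disjoint_left.1 h (hP.mem_of_mk_eq hx hxy.symm) hy

lemma cosetCount_pos {K : AddSubgroup G} [Finite (G ⧸ K)] {P : Set G} (hP : P.Nonempty) :
    0 < cosetCount K P :=
  (Set.ncard_pos (Set.toFinite _)).2 (hP.image _)

lemma cosetCount_lt {K : AddSubgroup G} [Finite (G ⧸ K)] {P Q : Set G} (hP : Per K P)
    (h : P ⊆ Q) (hne : ¬ Q ⊆ P) : cosetCount K P < cosetCount K Q := by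
  have h1 := cosetCount_union hP (Set.disjoint_sdiff_right (s := P) (t := Q))
  rw [Set.union_sdiff_cancel h] at h1
  have := cosetCount_pos (K := K) (Set.sdiff_nonempty.2 hne)
  omega

lemma cosetCount_mul_le {H₁ H₂ : AddSubgroup G} [Finite (G ⧸ (H₁ ⊓ H₂))] {W U D : Set G}
    (hW : W ⊆ H₁) (hU : U ⊆ H₂) (p : G) (hD : ∀ w ∈ W, ∀ u ∈ U, p + w + u ∈ D) :
    cosetCount (H₁ ⊓ H₂) W * cosetCount (H₁ ⊓ H₂) U ≤ cosetCount (H₁ ⊓ H₂) D := by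
  rw [cosetCount, cosetCount, cosetCount, ← Set.ncard_prod]
  refine Set.ncard_le_ncard_of_injOn (fun z => (p : G ⧸ (H₁ ⊓ H₂)) + z.1 + z.2) ?_ ?_
    (Set.toFinite _)
  · rintro ⟨_, _⟩ ⟨⟨w, hw, rfl⟩, ⟨u, hu, rfl⟩⟩
    exact ⟨p + w + u, hD w hw u hu, rfl⟩
  · rintro ⟨_, _⟩ ⟨⟨w, hw, rfl⟩, ⟨u, hu, rfl⟩⟩ ⟨_, _⟩ ⟨⟨w', hw', rfl⟩, ⟨u', hu', rfl⟩⟩ h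
    have h1 : ((p + w + u : G) : G ⧸ (H₁ ⊓ H₂)) = ((p + w' + u' : G) : G ⧸ (H₁ ⊓ H₂)) := h
    rw [QuotientAddGroup.eq] at h1
    have e : -(p + w + u) + (p + w' + u') = (-w + w') + (-u + u') := by abel
    rw [e] at h1
    have a1 : -w + w' ∈ H₁ := H₁.add_mem (H₁.neg_mem (hW hw)) (hW hw')
    have a2 : -u + u' ∈ H₂ := H₂.add_mem (H₂.neg_mem (hU hu)) (hU hu')
    have b1 : -u + u' ∈ H₁ := by simpa using H₁.sub_mem h1.1 a1
    have b2 : -w + w' ∈ H₂ := by simpa using H₂.sub_mem h1.2 a2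
    exact Prod.ext (QuotientAddGroup.eq.2 ⟨a1, b2⟩) (QuotientAddGroup.eq.2 ⟨b1, a2⟩)

lemma cosetCount_subgroup_lt {H₁ H₂ : AddSubgroup G} [Finite (G ⧸ (H₁ ⊓ H₂))] {P₁ P₂ : Set G}
    (h₁ : Per H₁ P₁) (h₂ : Per H₂ P₂) (hne : ¬ P₂ ⊆ P₁)
    (hc₁ : cosetCount (H₁ ⊓ H₂) (P₂ \ P₁) + 1 < cosetCount (H₁ ⊓ H₂) H₁)
    (hc₂ : cosetCount (H₁ ⊓ H₂) (P₁ \ P₂) + 1 < cosetCount (H₁ ⊓ H₂) H₂) :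
    cosetCount (H₁ ⊓ H₂) (H₂ : Set G) < cosetCount (H₁ ⊓ H₂) (H₁ : Set G) := by
  obtain ⟨p, hp2, hp1⟩ := Set.not_subset.1 hne
  set L := H₁ ⊓ H₂ with hL
  have hL1 : L ≤ H₁ := inf_le_left
  have hL2 : L ≤ H₂ := inf_le_right
  have q1 : Per L (shift (-p) P₁) := (h₁.mono hL1).shift _
  have q2 : Per L (shift (-p) P₂) := (h₂.mono hL2).shift _
  have s1 := (per_self H₁).mono hL1
  have s2 := (per_self H₂).mono hL2
  have e1 := cosetCount_union (s1.inter q2)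
    (Set.disjoint_left.2 fun x hx hx' => hx'.2 hx.2 : Disjoint _ ((H₁ : Set G) \ shift (-p) P₂))
  rw [Set.inter_union_sdiff] at e1
  have e2 := cosetCount_union (s2.inter q1)
    (Set.disjoint_left.2 fun x hx hx' => hx'.2 hx.2 : Disjoint _ ((H₂ : Set G) \ shift (-p) P₁))
  rw [Set.inter_union_sdiff] at e2
  have w1 : 0 < cosetCount L ((H₁ : Set G) ∩ shift (-p) P₂) :=
    cosetCount_pos ⟨0, H₁.zero_mem, by simpa [mem_shift] using hp2⟩
  have u1 : 0 < cosetCount L ((H₂ : Set G) \ shift (-p) P₁) :=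
    cosetCount_pos ⟨0, H₂.zero_mem, by simpa [mem_shift] using hp1⟩
  have m1 : cosetCount L ((H₁ : Set G) ∩ shift (-p) P₂) *
      cosetCount L ((H₂ : Set G) \ shift (-p) P₁) ≤ cosetCount L (P₂ \ P₁) := by
    refine cosetCount_mul_le Set.inter_subset_left Set.sdiff_subset p ?_
    rintro w ⟨hw, hw'⟩ u ⟨hu, hu'⟩
    rw [mem_shift_neg] at hw' hu'
    refine ⟨by simpa [add_comm] using h₂ _ hw' u hu, fun h => hu' ?_⟩
    have := h₁ _ h _ (H₁.neg_mem hw)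
    rwa [show p + w + u + -w = u + p by abel] at this
  have m2 : cosetCount L ((H₁ : Set G) \ shift (-p) P₂) *
      cosetCount L ((H₂ : Set G) ∩ shift (-p) P₁) ≤ cosetCount L (P₁ \ P₂) := by
    refine cosetCount_mul_le Set.sdiff_subset Set.inter_subset_left p ?_
    rintro w ⟨hw, hw'⟩ u ⟨hu, hu'⟩
    rw [mem_shift_neg] at hw' hu'
    refine ⟨?_, fun h => hw' ?_⟩
    · have := h₁ _ hu' w hw
      rwa [show u + p + w = p + w + u by abel] at this
    · have := h₂ _ h _ (H₂.neg_mem hu)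
      rwa [show p + w + u + -u = w + p by abel] at this
  generalize cosetCount L ((H₁ : Set G) ∩ shift (-p) P₂) = w at *
  generalize cosetCount L ((H₁ : Set G) \ shift (-p) P₂) = w' at *
  generalize cosetCount L ((H₂ : Set G) ∩ shift (-p) P₁) = u at *
  generalize cosetCount L ((H₂ : Set G) \ shift (-p) P₁) = u' at *
  have f1 : w * u' + 1 < w + w' := by omega
  have f2 : w' * u + 1 < u + u' := by omega
  rw [e1, e2]
  obtain ⟨a, rfl⟩ : ∃ a, u' = a + 1 := ⟨u' - 1, by omega⟩
  have g1 : a ≤ w * a := Nat.le_mul_of_pos_left a w1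
  rcases Nat.eq_zero_or_pos w' with rfl | hw'
  · rw [mul_add] at f1
    omega
  rcases Nat.eq_zero_or_pos u with rfl | hu
  · rw [mul_add] at f1
    omega
  · obtain ⟨b, rfl⟩ : ∃ b, w' = b + 1 := ⟨w' - 1, by omega⟩
    have g2 : b ≤ b * u := Nat.le_mul_of_pos_right b hu
    rw [mul_add] at f1
    rw [add_mul] at f2
    omega

lemma IsContent.union_per {μ : Set G → ℝ} (hμ : IsContent μ) {H₁ H₂ : AddSubgroup G}
    [Finite (G ⧸ (H₁ ⊓ H₂))] {P₁ P₂ : Set G} (h₁ : Per H₁ P₁) (h₂ : Per H₂ P₂)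
    (hne₁ : ¬ P₁ ⊆ P₂) (hne₂ : ¬ P₂ ⊆ P₁) :
    μ P₁ + μ (H₁ : Set G) ≤ μ (P₁ ∪ P₂) + μ (↑(H₁ ⊓ H₂) : Set G) ∨
      μ P₂ + μ (H₂ : Set G) ≤ μ (P₁ ∪ P₂) + μ (↑(H₁ ⊓ H₂) : Set G) := by
  have hL1 : H₁ ⊓ H₂ ≤ H₁ := inf_le_left
  have hL2 : H₁ ⊓ H₂ ≤ H₂ := inf_le_right
  have hor : cosetCount (H₁ ⊓ H₂) (H₁ : Set G) ≤ cosetCount (H₁ ⊓ H₂) (P₂ \ P₁) + 1 ∨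
      cosetCount (H₁ ⊓ H₂) (H₂ : Set G) ≤ cosetCount (H₁ ⊓ H₂) (P₁ \ P₂) + 1 := by
    by_contra! hcon
    have a1 := cosetCount_subgroup_lt h₁ h₂ hne₂ hcon.1 hcon.2
    have : Finite (G ⧸ (H₂ ⊓ H₁)) := by rwa [inf_comm]
    rw [inf_comm H₁ H₂] at hcon a1
    have a2 := cosetCount_subgroup_lt h₂ h₁ hne₁ hcon.2 hcon.1
    omega
  have q1 := h₁.mono hL1
  have q2 := h₂.mono hL2
  have n0 := hμ.nonneg (↑(H₁ ⊓ H₂) : Set G)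
  rcases hor with h | h
  · left
    have h' : (cosetCount (H₁ ⊓ H₂) (H₁ : Set G) : ℝ) ≤
        cosetCount (H₁ ⊓ H₂) (P₂ \ P₁) + 1 := by exact_mod_cast h
    have := mul_le_mul_of_nonneg_right h' n0
    rw [← hμ.per_eq_cosetCount ((per_self H₁).mono hL1), add_mul, one_mul,
      ← hμ.per_eq_cosetCount (q2.diff q1)] at this
    rw [hμ.union_eq]
    linarith
  · right
    have h' : (cosetCount (H₁ ⊓ H₂) (H₂ : Set G) : ℝ) ≤
        cosetCount (H₁ ⊓ H₂) (P₁ \ P₂) + 1 := by exact_mod_cast h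
    have := mul_le_mul_of_nonneg_right h' n0
    rw [← hμ.per_eq_cosetCount ((per_self H₂).mono hL2), add_mul, one_mul,
      ← hμ.per_eq_cosetCount (q1.diff q2)] at this
    rw [Set.union_comm, hμ.union_eq]
    linarith

/-- The stabilizer of a set. -/
def stab (X : Set G) : AddSubgroup G where
  carrier := {g | ∀ x, x + g ∈ X ↔ x ∈ X}
  zero_mem' := fun x => by rw [add_zero]
  add_mem' := fun {a b} ha hb x => by rw [← add_assoc, hb, ha]
  neg_mem' := fun {a} ha x => by rw [← ha (x + -a), neg_add_cancel_right]

lemma mem_stab {X : Set G} {g : G} : g ∈ stab X ↔ ∀ x, x + g ∈ X ↔ x ∈ X := Iff.rfl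

lemma per_stab (X : Set G) : Per (stab X) X := fun x hx _ hk => (hk x).2 hx

lemma Per.le_stab {K : AddSubgroup G} {X : Set G} (hX : Per K X) : K ≤ stab X := by
  intro k hk x
  exact ⟨fun h => by simpa using hX _ h _ (K.neg_mem hk), fun h => hX x h k hk⟩

lemma Per.mem_stab {K : AddSubgroup G} [Finite (G ⧸ K)] {X : Set G} (hX : Per K X) {y : G}
    (hy : ∀ x ∈ X, x + y ∈ X) : y ∈ stab X := by
  have hmul : ∀ n : ℕ, ∀ x ∈ X, x + n • y ∈ X := by
    intro n
    induction n with
    | zero => intro x hx; simpa using hx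
    | succ n ih =>
      intro x hx
      rw [succ_nsmul, ← add_assoc]
      exact hy _ (ih x hx)
  intro x
  refine ⟨fun h => ?_, hy x⟩
  have hpos : 0 < Nat.card (G ⧸ K) := Nat.card_pos
  obtain ⟨n, hn⟩ : ∃ n, Nat.card (G ⧸ K) = n + 1 := ⟨Nat.card (G ⧸ K) - 1, by omega⟩
  have hk : (n + 1) • y ∈ K := by
    rw [← QuotientAddGroup.eq_zero_iff, QuotientAddGroup.mk_nsmul, ← hn]
    exact card_nsmul_eq_zero'
  have h1 := hX _ (hmul n _ h) _ (K.neg_mem hk)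
  rwa [show x + y + n • y + -((n + 1) • y) = x by rw [succ_nsmul]; abel] at h1

lemma IsContent.exists_per_mem {μ : Set G → ℝ} (hμ : IsContent μ) {K : AddSubgroup G}
    [Finite (G ⧸ K)] (C : Set G) (c : G) (v : ℝ) (n : ℕ) :
    ∀ X Y : Set G, Per K X → Per K Y → cosetCount K Y = n → c ∈ X → (0 : G) ∈ Y →
      X + Y ⊆ C → v ≤ μ X + μ Y →
      ∃ (P : Set G) (H : AddSubgroup G), K ≤ H ∧ Per H P ∧ c ∈ P ∧ P ⊆ C ∧
        v ≤ μ P + μ (H : Set G) := by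
  induction n using Nat.strong_induction_on with
  | _ n ih =>
  intro X Y hX hY hn hc h0 hXY hv
  by_cases hall : ∀ e ∈ X, ∀ y ∈ Y, y + e ∈ X
  · refine ⟨X, stab X, hX.le_stab, per_stab X, hc, fun x hx => hXY ⟨x, hx, 0, h0, add_zero x⟩,
      hv.trans (add_le_add_right (hμ.mono fun y hy => hX.mem_stab fun x hx => ?_) _)⟩
    rw [add_comm]
    exact hall x hx y hy
  · push Not at hall
    obtain ⟨e, he, y, hy, hye⟩ := hall
    have hY' : Per K (Y ∩ shift (-e) X) := hY.inter (hX.shift _)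
    refine ih _ ?_ (X ∪ shift e Y) (Y ∩ shift (-e) X) (hX.union (hY.shift _)) hY' rfl
      (Or.inl hc) ⟨h0, by simpa [mem_shift] using he⟩ ?_ ?_
    · rw [← hn]
      refine cosetCount_lt hY' Set.inter_subset_left fun h => hye ?_
      exact mem_shift_neg.1 (h hy).2
    · rintro _ ⟨x, hx | hx, z, hz, rfl⟩
      · exact hXY ⟨x, hx, z, hz.1, rfl⟩
      · exact hXY ⟨z + e, mem_shift_neg.1 hz.2, x - e, hx, by dsimp; abel⟩
    · have h1 : μ (Y ∩ shift (-e) X) = μ (X ∩ shift e Y) := by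
        rw [← hμ.map_shift e (Y ∩ shift (-e) X)]
        congr 1
        ext x
        simp [mem_shift, and_comm]
      have h2 := hμ.union_add_inter X (shift e Y)
      rw [hμ.map_shift] at h2
      linarith

/-- Kneser's inequality for sets periodic modulo a subgroup of finite index. -/
lemma IsContent.kneser {μ : Set G → ℝ} (hμ : IsContent μ) {K : AddSubgroup G}
    [Finite (G ⧸ K)] {A B : Set G} (hA : Per K A) (hB : Per K B) (hA' : A.Nonempty)
    (hB' : B.Nonempty) :
    ∃ H : AddSubgroup G, K ≤ H ∧ Per H (A + B) ∧ μ A + μ B ≤ μ (A + B) + μ (H : Set G) := by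
  have hex : ∀ c ∈ A + B, ∃ (P : Set G) (H : AddSubgroup G), K ≤ H ∧ Per H P ∧ c ∈ P ∧
      P ⊆ A + B ∧ μ A + μ B ≤ μ P + μ (H : Set G) := by
    rintro _ ⟨a, ha, b, hb, rfl⟩
    refine hμ.exists_per_mem (A + B) (a + b) _ _ (shift b A) (shift (-b) B) (hA.shift _)
      (hB.shift _) rfl (by simpa [mem_shift] using ha) (by simpa [mem_shift] using hb) ?_
      (by rw [hμ.map_shift, hμ.map_shift])
    rintro _ ⟨x, hx, y, hy, rfl⟩
    exact ⟨x - b, hx, y + b, mem_shift_neg.1 hy, by dsimp; abel⟩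
  let S : Set ℕ := {n | ∃ (P : Set G) (H : AddSubgroup G), K ≤ H ∧ Per H P ∧ P.Nonempty ∧
      P ⊆ A + B ∧ μ A + μ B ≤ μ P + μ (H : Set G) ∧ cosetCount K P = n}
  have hS : S.Nonempty := by
    obtain ⟨c, hc⟩ := hA'.add hB'
    obtain ⟨P, H, h1, h2, h3, h4, h5⟩ := hex c hc
    exact ⟨_, P, H, h1, h2, ⟨c, h3⟩, h4, h5, rfl⟩
  have hbdd : BddAbove S := by
    refine ⟨Nat.card (G ⧸ K), ?_⟩
    rintro _ ⟨P, H, -, -, -, -, -, rfl⟩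
    exact Set.ncard_le_card _
  obtain ⟨P, H, h1, h2, h3, h4, h5, h6⟩ := Nat.sSup_mem hS hbdd
  suffices hsub : A + B ⊆ P by
    obtain rfl : P = A + B := h4.antisymm hsub
    exact ⟨H, h1, h2, h5⟩
  by_contra hsub
  obtain ⟨c, hc, hcP⟩ := Set.not_subset.1 hsub
  obtain ⟨P', H', h1', h2', h3', h4', h5'⟩ := hex c hc
  have hlt : ∀ (Q : Set G) (L : AddSubgroup G), K ≤ L → Per L Q → Q ⊆ A + B →
      μ A + μ B ≤ μ Q + μ (L : Set G) → P ⊆ Q → c ∈ Q → False := by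
    intro Q L hL hQ hQ' hv hPQ hcQ
    have := le_csSup hbdd (show cosetCount K Q ∈ S from
      ⟨Q, L, hL, hQ, ⟨c, hcQ⟩, hQ', hv, rfl⟩)
    have := cosetCount_lt (h2.mono h1) hPQ fun h => hcP (h hcQ)
    omega
  by_cases hPP : P ⊆ P'
  · exact hlt P' H' h1' h2' h4' h5' hPP h3'
  have : Finite (G ⧸ (H ⊓ H')) :=
    Finite.of_surjective _ (QuotientAddGroup.map_surjective_of_surjective K (H ⊓ H')
      (AddMonoidHom.id G) (QuotientAddGroup.mk_surjective) (le_inf h1 h1'))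
  refine hlt (P ∪ P') (H ⊓ H') (le_inf h1 h1')
    ((h2.mono inf_le_left).union (h2'.mono inf_le_right)) (Set.union_subset h4 h4') ?_
    Set.subset_union_left (Or.inr h3')
  rcases hμ.union_per h2 h2' hPP (fun h => hcP (h h3')) with h | h
  · exact h5.trans h
  · exact h5'.trans h

end Kneser

section AlmostPeriods

variable {G : Type*} [AddCommGroup G]

/-- The iterated sumset `T + ⋯ + T`. -/
def iteratedSum (T : Set G) : ℕ → Set G
  | 0 => {0}
  | k + 1 => iteratedSum T k + T

lemma iteratedSum_add_subset (T : Set G) (a b : ℕ) :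
    iteratedSum T a + iteratedSum T b ⊆ iteratedSum T (a + b) := by
  induction b with
  | zero => simp [iteratedSum]
  | succ b ih =>
    rw [← add_assoc, iteratedSum, iteratedSum, ← add_assoc]
    exact Set.add_subset_add_right ih

lemma iteratedSum_mono {T : Set G} (h0 : (0 : G) ∈ T) : Monotone (iteratedSum T) :=
  monotone_nat_of_le_succ fun _ x hx => ⟨x, hx, 0, h0, add_zero x⟩

lemma neg_mem_iteratedSum {T : Set G} (hT : ∀ x ∈ T, -x ∈ T) (k : ℕ) {x : G}
    (hx : x ∈ iteratedSum T k) : -x ∈ iteratedSum T k := by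
  induction k generalizing x with
  | zero => simpa [iteratedSum] using hx
  | succ k ih =>
    obtain ⟨y, hy, t, ht, rfl⟩ := hx
    exact ⟨-y, ih hy, -t, hT t ht, by dsimp; abel⟩

lemma IsContent.exists_iteratedSum_subset {η : Set G → ℝ} (hη : IsContent η) {τ : ℝ} {J : ℕ}
    (hJ : 1 < J * τ) {T : Set G} (h0 : (0 : G) ∈ T) (hneg : ∀ x ∈ T, -x ∈ T) (hT : τ ≤ η T) :
    ∃ j < J, iteratedSum T (3 * j + 3) ⊆ iteratedSum T (3 * j + 2) := by
  by_contra! hcon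
  have hch : ∀ j, ∃ h, j < J → h ∈ iteratedSum T (3 * j + 3) ∧ h ∉ iteratedSum T (3 * j + 2) := by
    intro j
    by_cases hj : j < J
    · obtain ⟨h, h1, h2⟩ := Set.not_subset.1 (hcon j hj)
      exact ⟨h, fun _ => ⟨h1, h2⟩⟩
    · exact ⟨0, fun h => absurd h hj⟩
  choose h hh using hch
  have hlt : ∀ i j, i < j → j < J → Disjoint (shift (h i) T) (shift (h j) T) := by
    intro i j hij hj
    refine Set.disjoint_left.2 fun x hx hx' => (hh j hj).2 ?_
    have h1 : h i + (x - h i) + -(x - h j) ∈ iteratedSum T (3 * i + 3 + 1 + 1) :=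
      ⟨_, ⟨_, (hh i (hij.trans hj)).1, _, hx, rfl⟩, _, hneg _ hx', rfl⟩
    rw [show h i + (x - h i) + -(x - h j) = h j by abel] at h1
    exact iteratedSum_mono h0 (by omega) h1
  have hsum := hη.sum_le_one (Finset.range J) (fun j => shift (h j) T) fun i hi j hj hij => by
    rcases lt_or_gt_of_ne hij with h' | h'
    · exact hlt i j h' (Finset.mem_range.1 hj)
    · exact (hlt j i h' (Finset.mem_range.1 hi)).symm
  simp only [hη.map_shift, Finset.sum_const, Finset.card_range, nsmul_eq_mul] at hsum
  have : (J : ℝ) * τ ≤ J * η T := mul_le_mul_of_nonneg_left hT (Nat.cast_nonneg J)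
  linarith

/-- A set of almost periods of positive content generates a subgroup of almost periods. -/
lemma IsContent.exists_subgroup {η : Set G → ℝ} (hη : IsContent η) {τ : ℝ} {J : ℕ}
    (hJ : 1 < J * τ) {p : G → ℝ} (p0 : p 0 = 0) (padd : ∀ x y, p (x + y) ≤ p x + p y)
    (pneg : ∀ x, p (-x) = p x) {ε : ℝ} (hε : 0 ≤ ε) (hT : τ ≤ η {x | p x ≤ ε}) :
    ∃ H : AddSubgroup G, (∀ x, p x ≤ ε → x ∈ H) ∧ ∀ h ∈ H, p h ≤ (3 * J + 2) * ε := by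
  set T : Set G := {x | p x ≤ ε}
  have h0 : (0 : G) ∈ T := by simpa [T, p0] using hε
  have hneg : ∀ x ∈ T, -x ∈ T := fun x hx => by simpa [T, pneg] using hx
  obtain ⟨j, hj, hsub⟩ := hη.exists_iteratedSum_subset hJ h0 hneg hT
  have hall : ∀ n, iteratedSum T (3 * j + 2 + n) ⊆ iteratedSum T (3 * j + 2) := by
    intro n
    induction n with
    | zero => rfl
    | succ n ih => exact (Set.add_subset_add_right ih).trans hsub
  have hp : ∀ k : ℕ, ∀ x ∈ iteratedSum T k, p x ≤ k * ε := by
    intro k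
    induction k with
    | zero => intro x hx; simp [iteratedSum] at hx; simp [hx, p0]
    | succ k ih =>
      rintro _ ⟨y, hy, t, ht, rfl⟩
      have h1 := padd y t
      have h2 := ih y hy
      have h3 : p t ≤ ε := ht
      push_cast
      linarith
  refine ⟨{ carrier := iteratedSum T (3 * j + 2)
            zero_mem' := iteratedSum_mono h0 (Nat.zero_le _) rfl
            add_mem' := fun ha hb => hall _ (iteratedSum_add_subset T _ _ ⟨_, ha, _, hb, rfl⟩)
            neg_mem' := fun ha => neg_mem_iteratedSum hneg _ ha }, ?_, ?_⟩
  · intro x hx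
    refine iteratedSum_mono h0 (show 1 ≤ 3 * j + 2 by omega) ?_
    exact ⟨0, rfl, x, hx, zero_add x⟩
  · intro x hx
    refine (hp _ x hx).trans (mul_le_mul_of_nonneg_right ?_ hε)
    have : (j : ℝ) < J := by exact_mod_cast hj
    push_cast
    linarith

end AlmostPeriods

section Cosets

variable {G : Type*} [AddCommGroup G] {μ ν η : Set G → ℝ}

namespace IsContent

lemma inter_shift_neg (hμ : IsContent μ) (y : G) (E Z : Set G) :
    μ (E ∩ shift (-y) Z) = μ (shift y E ∩ Z) := by
  rw [← hμ.map_shift y (E ∩ shift (-y) Z)]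
  congr 1
  ext x
  simp [mem_shift]

lemma diff_comm (hμ : IsContent μ) {S T : Set G} (h : μ S = μ T) : μ (S \ T) = μ (T \ S) := by
  have h1 := hμ.diff_add_inter S T
  have h2 := hμ.diff_add_inter T S
  rw [Set.inter_comm] at h2
  linarith

lemma shift_diff (hμ : IsContent μ) (g : G) (S : Set G) :
    μ (shift g S \ S) = μ (S \ shift g S) :=
  hμ.diff_comm (hμ.map_shift g S)

lemma diff_shift_neg (hμ : IsContent μ) (g : G) (S : Set G) :
    μ (S \ shift (-g) S) = μ (S \ shift g S) := by
  rw [← hμ.shift_diff g, ← hμ.map_shift g (S \ shift (-g) S)]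
  congr 1
  ext x
  simp [mem_shift]

lemma diff_shift_add (hμ : IsContent μ) (g h : G) (S : Set G) :
    μ (S \ shift (g + h) S) ≤ μ (S \ shift g S) + μ (S \ shift h S) := by
  rw [← hμ.map_shift g (S \ shift h S)]
  refine hμ.le_add fun x hx => ?_
  by_cases hg : x ∈ shift g S
  · refine Or.inr ⟨hg, fun h' => hx.2 ?_⟩
    rw [mem_shift] at h'
    rwa [mem_shift, ← sub_sub]
  · exact Or.inl ⟨hx.1, hg⟩

lemma coset_full (hν : IsContent ν) (hη : IsContent η) (hm : Mixes ν η) {K : AddSubgroup G}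
    [Finite (G ⧸ K)] {q r : G ⧸ K} {X Y C : Set G} (hX : X ⊆ fiber K q) (hY : Y ⊆ fiber K r)
    (h : ∀ y ∈ Y, ν (shift y X \ C) = 0) (hlt : ν (K : Set G) < ν X + η Y) :
    ν (fiber K (q + r) \ C) = 0 := by
  by_contra hne
  have hpos : 0 < ν (fiber K (q + r) \ C) := lt_of_le_of_ne (hν.nonneg _) (Ne.symm hne)
  have hup := hm.upper X (fiber K (q + r) \ C) (fiber K r \ Y) _ hpos.le (fun y _ => by
    rw [hν.inter_shift_neg]
    exact hν.mono Set.inter_subset_right) fun y hy => by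
      rw [hν.inter_shift_neg]
      by_cases hy' : y ∈ Y
      · refine hν.null_of_subset ?_ (h y hy')
        exact fun x hx => ⟨hx.1, hx.2.2⟩
      · rw [← hν.empty]
        congr 1
        refine Set.eq_empty_iff_forall_notMem.2 fun x hx => hy ⟨?_, hy'⟩
        have h1 : ((x - y : G) : G ⧸ K) = q := hX hx.1
        have h2 : (x : G ⧸ K) = q + r := hx.2.1
        rw [QuotientAddGroup.mk_sub, h2, sub_eq_iff_eq_add, add_right_inj] at h1
        exact h1.symm
  rw [hη.diff_subset hY, hη.fiber_eq, ← hν.subgroup_eq hη, mul_comm] at hup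
  have := le_of_mul_le_mul_left hup hpos
  linarith

lemma near_full (hμ : IsContent μ) (hm : Mixes μ μ) {H : AddSubgroup G} {ε : ℝ} (hε : 0 ≤ ε)
    {X : Set G} (hX : ∀ h ∈ H, μ (X \ shift h X) ≤ ε) (q : G ⧸ H) :
    μ (X ∩ fiber H q) ≤ 2 * ε ∨ μ (H : Set G) - 2 * ε ≤ μ (X ∩ fiber H q) := by
  by_contra! hcon
  obtain ⟨h1, h2⟩ := hcon
  have hlow := hm.lower (X ∩ fiber H q) (X ∩ fiber H q) H (μ (X ∩ fiber H q) - ε)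
    (by linarith) fun y hy => by
      have h3 : μ (X ∩ fiber H q) ≤
          μ (X ∩ fiber H q ∩ shift (-y) (X ∩ fiber H q)) + μ (X \ shift (-y) X) := by
        refine hμ.le_add fun x hx => ?_
        by_cases hxy : x ∈ shift (-y) X
        · exact Or.inl ⟨hx, hxy, by
            have := per_fiber H q x hx.2 y hy
            rwa [sub_neg_eq_add]⟩
        · exact Or.inr ⟨hx.1, hxy⟩
      have h4 := hX (-y) (H.neg_mem hy)
      linarith
  generalize μ (X ∩ fiber H q) = α at *
  generalize μ (H : Set G) = m at *
  rcases le_total (2 * α) m with h | h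
  · nlinarith [mul_lt_mul_of_pos_right h1 (show 0 < m - α by linarith)]
  · nlinarith [mul_lt_mul_of_pos_left (show 2 * ε < m - α by linarith) (show 0 < α by linarith)]

/-- The union of the cosets of `H` that are filled by `X` up to `2 * ε`. -/
def fullPart (μ : Set G → ℝ) (H : AddSubgroup G) (ε : ℝ) (X : Set G) : Set G :=
  {x | μ (H : Set G) - 2 * ε ≤ μ (X ∩ fiber H (x : G ⧸ H))}

lemma per_fullPart (μ : Set G → ℝ) (H : AddSubgroup G) (ε : ℝ) (X : Set G) :
    Per H (fullPart μ H ε X) := by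
  intro x hx k hk
  have : ((x + k : G) : G ⧸ H) = x := by
    rw [eq_comm, QuotientAddGroup.eq]
    simpa using hk
  rw [fullPart, Set.mem_ofPred_eq, this]
  exact hx

lemma diff_fullPart (hμ : IsContent μ) (hm : Mixes μ μ) {H : AddSubgroup G} [Finite (G ⧸ H)]
    {ε : ℝ} (hε : 0 ≤ ε) {X : Set G} (hX : ∀ h ∈ H, μ (X \ shift h X) ≤ ε) :
    μ (X \ fullPart μ H ε X) * μ (H : Set G) ≤ 2 * ε := by
  have := Fintype.ofFinite (G ⧸ H)
  have hle : ∀ q : G ⧸ H, μ ((X \ fullPart μ H ε X) ∩ fiber H q) ≤ 2 * ε := by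
    intro q
    rcases hμ.near_full hm hε hX q with h | h
    · exact (hμ.mono (Set.inter_subset_inter_left _ Set.sdiff_subset)).trans h
    · have : (X \ fullPart μ H ε X) ∩ fiber H q = ∅ := by
        refine Set.eq_empty_iff_forall_notMem.2 ?_
        rintro x ⟨⟨-, hx⟩, rfl⟩
        exact hx h
      rw [this, hμ.empty]
      linarith
  have hs : μ (X \ fullPart μ H ε X) ≤ Nat.card (G ⧸ H) * (2 * ε) := by
    rw [← hμ.sum_fiber H, Nat.card_eq_fintype_card, ← Finset.card_univ, ← nsmul_eq_mul]
    exact Finset.sum_le_card_nsmul _ _ _ fun q _ => hle q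
  have h1 := mul_le_mul_of_nonneg_right hs (hμ.nonneg (H : Set G))
  have h2 := hμ.card_mul_eq_one H
  calc _ ≤ _ := h1
    _ = (Nat.card (G ⧸ H) * μ (H : Set G)) * (2 * ε) := by ring
    _ = 2 * ε := by rw [h2, one_mul]

lemma fullPart_add_null (hν : IsContent ν) (hη : IsContent η) (hm : Mixes ν η)
    {H : AddSubgroup G} [Finite (G ⧸ H)] {ε : ℝ} (hε : 4 * ε < ν (H : Set G)) {X Y C : Set G}
    (h : ∀ y ∈ Y, ν (shift y X \ C) = 0) :
    ν ((fullPart ν H ε X + fullPart η H ε Y) \ C) = 0 := by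
  refine hν.null_of_fiber H fun s => ?_
  by_cases hs : ∃ x ∈ fullPart ν H ε X, ∃ y ∈ fullPart η H ε Y, (x : G ⧸ H) + y = s
  · obtain ⟨x, hx, y, hy, rfl⟩ := hs
    refine hν.null_of_subset ?_
      (hν.coset_full hη hm (q := (x : G ⧸ H)) (r := (y : G ⧸ H)) (X := X ∩ fiber H x)
        (Y := Y ∩ fiber H y) Set.inter_subset_right Set.inter_subset_right ?_ ?_ (C := C))
    · exact fun z hz => ⟨hz.2, hz.1.2⟩
    · intro t ht
      refine hν.null_of_subset ?_ (h t ht.1)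
      exact fun z hz => ⟨hz.1.1, hz.2⟩
    · have h1 : ν (H : Set G) - 2 * ε ≤ ν (X ∩ fiber H x) := hx
      have h2 : η (H : Set G) - 2 * ε ≤ η (Y ∩ fiber H y) := hy
      rw [← hν.subgroup_eq hη] at h2
      linarith
  · rw [← hν.empty]
    congr 1
    refine Set.eq_empty_iff_forall_notMem.2 ?_
    rintro _ ⟨⟨⟨x, hx, y, hy, rfl⟩, -⟩, hz⟩
    exact hs ⟨x, hx, y, hy, hz⟩

end IsContent

lemma finite_quotient_of_le {H K : AddSubgroup G} [Finite (G ⧸ H)] (h : H ≤ K) :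
    Finite (G ⧸ K) :=
  Finite.of_surjective _ (QuotientAddGroup.map_surjective_of_surjective H K
    (AddMonoidHom.id G) QuotientAddGroup.mk_surjective h)

end Cosets

section LocalStructure

variable {G : Type*} [AddCommGroup G] {ν η : Set G → ℝ}

/-- `(X, Y, E)` satisfies `X + Y ⊆ C` up to `ν`-null sets, with `0 ∈ Y`, and `E ⊆ X ∩ E₀` is
not null. -/
structure IsConfig (ν : Set G → ℝ) (C E₀ X Y E : Set G) : Prop where
  zero_mem : (0 : G) ∈ Y
  subset : E ⊆ X
  subset' : E ⊆ E₀
  pos : 0 < ν E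
  null : ∀ y ∈ Y, ν (shift y X \ C) = 0

/-- The quantity nearly maximized over configurations. -/
def energy (ν η : Set G → ℝ) (l : ℝ) (X Y : Set G) : ℝ := ν X + η Y + l * η Y ^ 2

namespace IsConfig

variable {C E₀ X Y E : Set G}

lemma union (hν : IsContent ν) (hc : IsConfig ν C E₀ X Y E) {g : G} (hg : g ∈ Y)
    (hE : 0 < ν (E ∩ shift (-g) X)) :
    IsConfig ν C E₀ (X ∪ shift g X) (Y ∩ shift (-g) Y) (E ∩ shift (-g) X) where
  zero_mem := ⟨hc.zero_mem, by simpa [mem_shift] using hg⟩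
  subset x hx := Or.inl (hc.subset hx.1)
  subset' x hx := hc.subset' hx.1
  pos := hE
  null y hy := by
    refine hν.null_of_subset ?_
      (hν.null_union (hc.null y hy.1) (hc.null (y + g) (mem_shift_neg.1 hy.2)))
    rintro x ⟨hx | hx, hxC⟩
    · exact Or.inl ⟨hx, hxC⟩
    · refine Or.inr ⟨?_, hxC⟩
      rwa [← shift_shift]

lemma inter (hν : IsContent ν) (hc : IsConfig ν C E₀ X Y E) {g : G}
    (hE : 0 < ν (E ∩ shift (-g) X)) :
    IsConfig ν C E₀ (X ∩ shift (-g) X) (Y ∪ shift g Y) (E ∩ shift (-g) X) where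
  zero_mem := Or.inl hc.zero_mem
  subset x hx := ⟨hc.subset hx.1, hx.2⟩
  subset' x hx := hc.subset' hx.1
  pos := hE
  null y hy := by
    rcases hy with hy | hy
    · refine hν.null_of_subset ?_ (hc.null y hy)
      exact fun x hx => ⟨hx.1.1, hx.2⟩
    · refine hν.null_of_subset ?_ (hc.null (y - g) hy)
      rintro x ⟨⟨-, hx⟩, hxC⟩
      refine ⟨?_, hxC⟩
      rw [mem_shift_neg] at hx
      rwa [mem_shift, show x - (y - g) = x - y + g by abel]

lemma almost_period (hν : IsContent ν) (hη : IsContent η) (hc : IsConfig ν C E₀ X Y E)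
    {l ε : ℝ} (hl : 0 ≤ l)
    (hmax : ∀ X' Y' E', IsConfig ν C E₀ X' Y' E' →
      energy ν η l X' Y' ≤ energy ν η l X Y + ε)
    {g : G} (hg : g ∈ Y) (hE : 0 < ν (E ∩ shift (-g) X)) :
    l * η (Y \ shift g Y) ^ 2 ≤ ε ∧
      ν (X \ shift g X) ≤ η (Y \ shift g Y) + ε + 2 * l * η (Y \ shift g Y) := by
  have h1 := hmax _ _ _ (hc.union hν hg hE)
  have h2 := hmax _ _ _ (hc.inter hν hE)
  have a1 : ν (X ∪ shift g X) = ν X + ν (X \ shift g X) := by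
    rw [hν.union_eq, hν.shift_diff]
  have a2 : η (Y ∩ shift (-g) Y) = η Y - η (Y \ shift g Y) := by
    rw [← hη.diff_shift_neg]
    linarith [hη.diff_add_inter Y (shift (-g) Y)]
  have a3 : ν (X ∩ shift (-g) X) = ν X - ν (X \ shift g X) := by
    rw [← hν.diff_shift_neg]
    linarith [hν.diff_add_inter X (shift (-g) X)]
  have a4 : η (Y ∪ shift g Y) = η Y + η (Y \ shift g Y) := by
    rw [hη.union_eq, hη.shift_diff]
  rw [energy, energy, a1, a2] at h1
  rw [energy, energy, a3, a4] at h2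
  have b0 := hη.nonneg (Y \ shift g Y)
  have b1 := hη.le_one Y
  generalize ν (X \ shift g X) = k at *
  generalize η (Y \ shift g Y) = d at *
  generalize η Y = b at *
  constructor
  · nlinarith
  · have e1 : l * (d * b) ≤ l * (d * 1) :=
      mul_le_mul_of_nonneg_left (mul_le_mul_of_nonneg_left b1 b0) hl
    have e2 : 0 ≤ l * d ^ 2 := mul_nonneg hl (sq_nonneg d)
    nlinarith

lemma measure_le (hν : IsContent ν) (hc : IsConfig ν C E₀ X Y E) :
    ν (C \ X) = ν C - ν X := by
  have h1 := hc.null 0 hc.zero_mem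
  rw [shift_zero] at h1
  have h2 := hν.diff_add_inter X C
  have h3 := hν.diff_add_inter C X
  rw [Set.inter_comm] at h3
  linarith

lemma exists_near_max (hν : IsContent ν) (hη : IsContent η) (hc : IsConfig ν C E₀ X Y E)
    {l ε : ℝ} (hl : 0 ≤ l) (hε : 0 < ε) :
    ∃ X' Y' E', IsConfig ν C E₀ X' Y' E' ∧ ∀ X'' Y'' E'', IsConfig ν C E₀ X'' Y'' E'' →
      energy ν η l X'' Y'' ≤ energy ν η l X' Y' + ε := by
  set S : Set ℝ := {s | ∃ X Y E, IsConfig ν C E₀ X Y E ∧ energy ν η l X Y = s} with hS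
  have hSne : S.Nonempty := ⟨_, X, Y, E, hc, rfl⟩
  have hSb : BddAbove S := by
    refine ⟨2 + l, ?_⟩
    rintro _ ⟨X, Y, E, -, rfl⟩
    have b0 := hη.nonneg Y
    have b1 := hη.le_one Y
    have b2 := hν.le_one X
    have b3 : η Y ^ 2 ≤ 1 := pow_le_one₀ b0 b1
    have b4 := mul_le_mul_of_nonneg_left b3 hl
    rw [energy]
    linarith
  obtain ⟨_, ⟨X, Y, E, hc, rfl⟩, hlt⟩ := exists_lt_of_lt_csSup hSne
    (show sSup S - ε < sSup S by linarith)
  refine ⟨X, Y, E, hc, fun X' Y' E' hc' => ?_⟩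
  have := le_csSup hSb (show energy ν η l X' Y' ∈ S from ⟨X', Y', E', hc', rfl⟩)
  linarith

/-- The elements of `Y` that carry a proportion `κ` of `E` into `X`. -/
def popular (ν : Set G → ℝ) (X Y E : Set G) (κ : ℝ) : Set G :=
  {y ∈ Y | κ * ν E ≤ ν (E ∩ shift (-y) X)}

lemma le_popular (hν : IsContent ν) (hη : IsContent η) (hνη : Mixes ν η)
    (hc : IsConfig ν C E₀ X Y E) {κ : ℝ} (hκ : 0 ≤ κ) (hκ' : κ ≤ 1) :
    ν X + η Y - ν C - κ ≤ η (popular ν X Y E κ) := by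
  have hlow := hνη.lower E (C \ X) (Y \ popular ν X Y E κ) ((1 - κ) * ν E)
    (mul_nonneg (by linarith) hc.pos.le) fun y hy => by
      have h2 : ν E ≤ ν (E ∩ shift (-y) (C \ X) ∪ E ∩ shift (-y) X) +
          ν (E ∩ shift (-y) Cᶜ) := by
        refine hν.le_add fun x hx => ?_
        by_cases h1 : x - -y ∈ X
        · exact Or.inl (Or.inr ⟨hx, h1⟩)
        · by_cases h2 : x - -y ∈ C
          · exact Or.inl (Or.inl ⟨hx, h2, h1⟩)
          · exact Or.inr ⟨hx, h2⟩
      have h3 : ν (E ∩ shift (-y) Cᶜ) = 0 := by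
        rw [hν.inter_shift_neg]
        refine hν.null_of_subset ?_ (hc.null y hy.1)
        exact fun x hx => ⟨hc.subset hx.1, hx.2⟩
      have h4 := hν.union_le (E ∩ shift (-y) (C \ X)) (E ∩ shift (-y) X)
      have h5 : ν (E ∩ shift (-y) X) < κ * ν E := by
        by_contra! hcon
        exact hy.2 ⟨hy.1, hcon⟩
      linarith
  have h1 : η (Y \ popular ν X Y E κ) * (1 - κ) ≤ ν (C \ X) := by
    refine le_of_mul_le_mul_left ?_ hc.pos
    linarith
  have h2 := hη.diff_subset (show popular ν X Y E κ ⊆ Y from fun y hy => hy.1)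
  have h3 : η (Y \ popular ν X Y E κ) * κ ≤ 1 * κ :=
    mul_le_mul_of_nonneg_right (hη.le_one _) hκ
  rw [hc.measure_le hν] at h1
  linarith

lemma exists_per (hν : IsContent ν) (hη : IsContent η) (hνη : Mixes ν η)
    (hνν : Mixes ν ν) (hηη : Mixes η η) (hc : IsConfig ν C E₀ X Y E) {H : AddSubgroup G}
    {ε τ κ : ℝ} (hε : 0 ≤ ε) (hτ : 4 * ε < τ) (hκ : 2 * ε < τ ^ 2 * κ)
    (hX : ∀ h ∈ H, ν (X \ shift h X) ≤ ε) (hY : ∀ h ∈ H, η (Y \ shift h Y) ≤ ε)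
    (hH : popular ν X Y E κ ⊆ H) (hpop : τ ≤ η (popular ν X Y E κ)) :
    ∃ (P : Set G) (L : AddSubgroup G), Finite (G ⧸ L) ∧ Per L P ∧ ν (P \ C) = 0 ∧
      0 < ν (E₀ ∩ P) ∧ ν X + η Y - 4 * ε / τ ≤ ν P + ν (L : Set G) := by
  have hτ0 : 0 < τ := by linarith
  have hHτ : τ ≤ η (H : Set G) := hpop.trans (hη.mono hH)
  have hfin : Finite (G ⧸ H) := hη.finite_quotient (by linarith)
  have hHν : ν (H : Set G) = η (H : Set G) := hν.subgroup_eq hη H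
  have hXs := hν.diff_fullPart hνν hε hX
  have hYs := hη.diff_fullPart hηη hε hY
  rw [hHν] at hXs
  have hXs' : ν (X \ IsContent.fullPart ν H ε X) * τ ≤ 2 * ε :=
    (mul_le_mul_of_nonneg_left hHτ (hν.nonneg _)).trans hXs
  have hYs' : η (Y \ IsContent.fullPart η H ε Y) * τ ≤ 2 * ε :=
    (mul_le_mul_of_nonneg_left hHτ (hη.nonneg _)).trans hYs
  have hPC := hν.fullPart_add_null hη hνη (ε := ε) (by linarith : 4 * ε < ν (H : Set G)) hc.null
  have pX := IsContent.per_fullPart ν H ε X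
  have pY := IsContent.per_fullPart η H ε Y
  have hY0 : (0 : G) ∈ IsContent.fullPart η H ε Y := by
    rcases hη.near_full hηη hε hY ((0 : G) : G ⧸ H) with h | h
    · have h1 : η (popular ν X Y E κ) ≤ η (Y ∩ fiber H ((0 : G) : G ⧸ H)) := by
        refine hη.mono fun y hy => ⟨hy.1, ?_⟩
        rw [fiber_mk, shift_zero]
        exact hH hy
      linarith
    · exact h
  have hEX : 0 < ν (E ∩ IsContent.fullPart ν H ε X) := by
    by_contra! hcon
    have hnull : ν (E ∩ IsContent.fullPart ν H ε X) = 0 := le_antisymm hcon (hν.nonneg _)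
    have hκ0 : 0 < κ := by
      by_contra! hκ0
      have := mul_nonpos_of_nonneg_of_nonpos (sq_nonneg τ) hκ0
      linarith
    have hlow := hνη.lower E (X \ IsContent.fullPart ν H ε X) (popular ν X Y E κ) (κ * ν E)
      (mul_nonneg hκ0.le hc.pos.le) fun y hy => by
        refine hy.2.trans ?_
        have h1 : ν (E ∩ shift (-y) X) ≤ ν (E ∩ IsContent.fullPart ν H ε X) +
            ν (E ∩ shift (-y) (X \ IsContent.fullPart ν H ε X)) := by
          refine hν.le_add fun x hx => ?_
          by_cases hxX : x ∈ IsContent.fullPart ν H ε X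
          · exact Or.inl ⟨hx.1, hxX⟩
          · refine Or.inr ⟨hx.1, hx.2, fun h => hxX ?_⟩
            have := pX _ h _ (H.neg_mem (hH hy))
            simpa using this
        linarith
    have h1 : η (popular ν X Y E κ) * κ ≤ ν (X \ IsContent.fullPart ν H ε X) := by
      refine le_of_mul_le_mul_left ?_ hc.pos
      linarith
    have h2 : τ * κ ≤ ν (X \ IsContent.fullPart ν H ε X) :=
      (mul_le_mul_of_nonneg_right hpop hκ0.le).trans h1
    have h3 := mul_le_mul_of_nonneg_right h2 hτ0.le
    nlinarith
  have hXne := hν.nonempty_of_pos hEX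
  obtain ⟨L, hL, hL1, hL2⟩ := hν.kneser pX pY (hXne.mono Set.inter_subset_right) ⟨0, hY0⟩
  refine ⟨_, L, finite_quotient_of_le hL, hL1, hPC, hEX.trans_le (hν.mono ?_), ?_⟩
  · exact fun x hx => ⟨hc.subset' hx.1, x, hx.2, 0, hY0, add_zero x⟩
  · have h1 := hν.le_add (show X ⊆ IsContent.fullPart ν H ε X ∪
        (X \ IsContent.fullPart ν H ε X) by rw [Set.union_sdiff_self]; exact Set.subset_union_right)
    have h2 := hη.le_add (show Y ⊆ IsContent.fullPart η H ε Y ∪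
        (Y \ IsContent.fullPart η H ε Y) by rw [Set.union_sdiff_self]; exact Set.subset_union_right)
    rw [hν.per_congr hη pY] at hL2
    rw [← le_div_iff₀ hτ0] at hXs' hYs'
    have h3 : 4 * ε / τ = 2 * ε / τ + 2 * ε / τ := by ring
    linarith

end IsConfig

/-- If `ν C < ν A + η B` where `A + B ⊆ C` up to `ν`-null sets, then every non-null part of
`A` meets a large periodic subset of `C`. -/
lemma IsContent.exists_per_of_zero_mem (hν : IsContent ν) (hη : IsContent η) (hνη : Mixes ν η)
    (hνν : Mixes ν ν) (hηη : Mixes η η) {A B C E₀ : Set G} {δ : ℝ} (h0 : (0 : G) ∈ B)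
    (hAB : ∀ b ∈ B, ν (shift b A \ C) = 0) (hδ : 0 < δ) (hδ' : ν C + δ = ν A + η B)
    (hE : E₀ ⊆ A) (hE' : 0 < ν E₀) :
    ∃ (P : Set G) (H : AddSubgroup G), Finite (G ⧸ H) ∧ Per H P ∧ ν (P \ C) = 0 ∧
      0 < ν (E₀ ∩ P) ∧ ν A + η B - δ / 2 ≤ ν P + ν (H : Set G) := by
  have hc0 : IsConfig ν C E₀ A B E₀ := ⟨h0, hE, subset_rfl, hE', hAB⟩
  have hδ1 : δ ≤ 1 := by
    linarith [hc0.measure_le hν, hν.nonneg (C \ A), hη.le_one B]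
  obtain ⟨J, hJ⟩ := exists_nat_gt (2 / δ)
  have hJ' : 1 < J * (δ / 2) := by
    rw [div_lt_iff₀ hδ] at hJ
    linarith
  have hJ0 : (0 : ℝ) ≤ J := Nat.cast_nonneg J
  obtain ⟨ε, hε⟩ : ∃ ε, ε = δ ^ 3 / 64 := ⟨_, rfl⟩
  have hδ2 : δ ^ 2 ≤ δ := by nlinarith
  have hδ3 : δ ^ 3 ≤ δ ^ 2 := by nlinarith [sq_nonneg δ]
  have hδ3' : 0 < δ ^ 3 := by positivity
  have hε0 : 0 < ε := by linarith
  obtain ⟨ε₂, hε₂⟩ : ∃ ε₂, ε₂ = ε / (4 * (3 * J + 2)) := ⟨_, rfl⟩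
  have hε₂0 : 0 < ε₂ := by rw [hε₂]; positivity
  have hε₂' : (3 * J + 2) * (4 * ε₂) = ε := by
    rw [hε₂]
    field_simp
  have hε₂1 : ε₂ ≤ 1 := by nlinarith [mul_nonneg hJ0 hε₂0.le]
  have hsq : ε₂ ^ 2 ≤ ε₂ := by nlinarith
  have hsq0 : 0 < ε₂ ^ 2 := by positivity
  have hl0 : 0 < δ / 8 := by positivity
  obtain ⟨X, Y, E, hc, hmax⟩ := hc0.exists_near_max hν hη hl0.le (mul_pos hl0 hsq0)
  have hl1 : δ / 8 * ε₂ ^ 2 ≤ 1 / 8 * ε₂ := by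
    have := mul_le_mul (show δ / 8 ≤ 1 / 8 by linarith) hsq hsq0.le (by norm_num)
    exact this
  have hval : ν A + η B - δ / 4 ≤ ν X + η Y := by
    have h1 := hmax _ _ _ hc0
    rw [energy, energy] at h1
    have b2 : η Y ^ 2 ≤ 1 := pow_le_one₀ (hη.nonneg Y) (hη.le_one Y)
    have h2 := mul_le_mul_of_nonneg_left b2 hl0.le
    have h3 := mul_le_mul_of_nonneg_left (hsq.trans hε₂1) hl0.le
    have h4 := mul_nonneg hl0.le (sq_nonneg (η B))
    linarith
  have hpop := hc.le_popular hν hη hνη (κ := δ / 4) (by linarith) (by linarith)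
  have hpop' : δ / 2 ≤ η (IsConfig.popular ν X Y E (δ / 4)) := by linarith
  obtain ⟨p, hp⟩ : ∃ p : G → ℝ, ∀ g, p g = ν (X \ shift g X) + η (Y \ shift g Y) :=
    ⟨_, fun _ => rfl⟩
  have hsub : IsConfig.popular ν X Y E (δ / 4) ⊆ {x | p x ≤ 4 * ε₂} := by
    intro y hy
    have hEpos : 0 < ν (E ∩ shift (-y) X) :=
      lt_of_lt_of_le (mul_pos (by linarith) hc.pos) hy.2
    obtain ⟨h1, h2⟩ := hc.almost_period hν hη hl0.le hmax hy.1 hEpos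
    have h4 := hη.nonneg (Y \ shift y Y)
    have h3 : η (Y \ shift y Y) ≤ ε₂ :=
      (pow_le_pow_iff_left₀ h4 hε₂0.le two_ne_zero).1 (le_of_mul_le_mul_left h1 hl0)
    have h5 := mul_le_mul (show δ / 8 ≤ 1 / 8 by linarith) h3 h4 (by norm_num)
    change p y ≤ 4 * ε₂
    rw [hp]
    linarith
  obtain ⟨H, hTH, hHp⟩ := hη.exists_subgroup hJ' (p := p) (ε := 4 * ε₂)
    (by simp [hp, shift_zero, hν.empty, hη.empty])
    (fun x y => by
      have h1 := hν.diff_shift_add x y X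
      have h2 := hη.diff_shift_add x y Y
      rw [hp, hp, hp]
      linarith)
    (fun x => by rw [hp, hp, hν.diff_shift_neg, hη.diff_shift_neg])
    (by positivity) (hpop'.trans (hη.mono hsub))
  rw [hε₂'] at hHp
  obtain ⟨P, L, h1, h2, h3, h4, h5⟩ := hc.exists_per hν hη hνη hνν hηη (H := H) (ε := ε)
    (τ := δ / 2) (κ := δ / 4) hε0.le (by linarith) (by rw [hε]; linarith)
    (fun h hh => by
      have h1 := hHp h hh
      rw [hp] at h1
      linarith [hη.nonneg (Y \ shift h Y)])
    (fun h hh => by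
      have h1 := hHp h hh
      rw [hp] at h1
      linarith [hν.nonneg (X \ shift h X)])
    (fun y hy => hTH y (hsub hy)) hpop'
  refine ⟨P, L, h1, h2, h3, h4, ?_⟩
  have h6 : 4 * ε / (δ / 2) = δ ^ 2 / 8 := by
    rw [hε]
    field_simp
    ring
  rw [h6] at h5
  linarith

end LocalStructure

section Pairs

variable {G : Type*} [AddCommGroup G] {μ ν η : Set G → ℝ}

lemma finite_quotient_inf (H K : AddSubgroup G) [hH : Finite (G ⧸ H)] [hK : Finite (G ⧸ K)] :
    Finite (G ⧸ (H ⊓ K)) := by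
  have h1 := AddSubgroup.finiteIndex_iff_finite_quotient.2 hH
  have h2 := AddSubgroup.finiteIndex_iff_finite_quotient.2 hK
  exact AddSubgroup.finiteIndex_iff_finite_quotient.1 inferInstance

lemma IsContent.mul_le_inf (hμ : IsContent μ) (H K : AddSubgroup G) [Finite (G ⧸ H)]
    [Finite (G ⧸ K)] : μ (H : Set G) * μ (K : Set G) ≤ μ (↑(H ⊓ K) : Set G) := by
  have := finite_quotient_inf H K
  have h1 := hμ.card_mul_eq_one H
  have h2 := hμ.card_mul_eq_one K
  have h3 := hμ.card_mul_eq_one (H ⊓ K)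
  have h4 : (Nat.card (G ⧸ (H ⊓ K)) : ℝ) ≤ Nat.card (G ⧸ H) * Nat.card (G ⧸ K) := by
    exact_mod_cast AddSubgroup.index_inf_le (H := H) (K := K)
  have h5 := hμ.nonneg (↑(H ⊓ K) : Set G)
  have h6 := mul_nonneg (hμ.nonneg (H : Set G)) (hμ.nonneg (K : Set G))
  calc _ = (Nat.card (G ⧸ (H ⊓ K)) * μ (↑(H ⊓ K) : Set G)) *
        (μ (H : Set G) * μ (K : Set G)) := by rw [h3, one_mul]
    _ = μ (↑(H ⊓ K) : Set G) * (Nat.card (G ⧸ (H ⊓ K)) *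
        (μ (H : Set G) * μ (K : Set G))) := by ring
    _ ≤ μ (↑(H ⊓ K) : Set G) * ((Nat.card (G ⧸ H) * Nat.card (G ⧸ K)) *
        (μ (H : Set G) * μ (K : Set G))) := by gcongr
    _ = μ (↑(H ⊓ K) : Set G) * ((Nat.card (G ⧸ H) * μ (H : Set G)) *
        (Nat.card (G ⧸ K) * μ (K : Set G))) := by ring
    _ = _ := by rw [h1, h2, one_mul, mul_one]

lemma IsContent.exists_per_inter_pos (hν : IsContent ν) (hη : IsContent η) (hνη : Mixes ν η)
    (hνν : Mixes ν ν) (hηη : Mixes η η) {A B C E₀ : Set G} {δ : ℝ} {b : G} (hb : b ∈ B)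
    (hAB : ∀ b ∈ B, ν (shift b A \ C) = 0) (hδ : 0 < δ) (hδ' : ν C + δ = ν A + η B)
    (hE : E₀ ⊆ shift b A) (hE' : 0 < ν E₀) :
    ∃ (P : Set G) (H : AddSubgroup G), Finite (G ⧸ H) ∧ Per H P ∧ ν (P \ C) = 0 ∧
      0 < ν (E₀ ∩ P) ∧ ν A + η B - δ / 2 ≤ ν P + ν (H : Set G) := by
  have h := hν.exists_per_of_zero_mem hη hνη hνν hηη (A := shift b A) (B := shift (-b) B)
    (C := C) (E₀ := E₀) (δ := δ) (by simpa [mem_shift] using hb) (fun y hy => by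
      rw [shift_shift]
      exact hAB _ (mem_shift_neg.1 hy)) hδ (by rw [hν.map_shift, hη.map_shift, hδ']) hE hE'
  rwa [hν.map_shift, hη.map_shift] at h

/-- If `ν C < ν A + η B` where `A + B ⊆ C` up to `ν`-null sets, then up to `ν`-null sets all
translates of `A` by `B` lie in a common periodic subset of `C`. -/
lemma IsContent.exists_per_null (hν : IsContent ν) (hη : IsContent η) (hνη : Mixes ν η)
    (hνν : Mixes ν ν) (hηη : Mixes η η) {A B C : Set G}
    (hAB : ∀ b ∈ B, ν (shift b A \ C) = 0) (hlt : ν C < ν A + η B) :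
    ∃ (P : Set G) (K : AddSubgroup G), Finite (G ⧸ K) ∧ Per K P ∧ ν (P \ C) = 0 ∧
      ∀ b ∈ B, ν (shift b A \ P) = 0 := by
  obtain ⟨δ, hδ⟩ : ∃ δ, δ = ν A + η B - ν C := ⟨_, rfl⟩
  have hδ0 : 0 < δ := by linarith
  let F : Set G → AddSubgroup G → Prop := fun P H => Finite (G ⧸ H) ∧ Per H P ∧
    ν (P \ C) = 0 ∧ ν A + η B - δ / 2 ≤ ν P + ν (H : Set G)
  let S : Set ℝ := {s | ∃ P H, F P H ∧ ν P = s}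
  have hLL : ∀ P b, b ∈ B → 0 < ν (shift b A \ P) → ∃ P' H', F P' H' ∧ ¬ P' ⊆ P := by
    intro P b hb hpos
    obtain ⟨P', H', h1, h2, h3, h4, h5⟩ := hν.exists_per_inter_pos hη hνη hνν hηη (C := C)
      (δ := δ) hb hAB hδ0 (by linarith) (Set.sdiff_subset (t := P)) hpos
    refine ⟨P', H', ⟨h1, h2, h3, h5⟩, fun hsub => ?_⟩
    obtain ⟨x, hx, hx'⟩ := hν.nonempty_of_pos h4
    exact hx.2 (hsub hx')
  have hzero : ∀ P b, ¬ 0 < ν (shift b A \ P) → ν (shift b A \ P) = 0 :=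
    fun P b h => le_antisymm (not_lt.1 h) (hν.nonneg _)
  rcases S.eq_empty_or_nonempty with hS | hS
  · refine ⟨∅, ⊤, inferInstance, fun x hx => hx.elim, by simp [hν.empty], fun b hb =>
      hzero _ _ fun hpos => ?_⟩
    obtain ⟨P', H', h, -⟩ := hLL ∅ b hb hpos
    exact Set.eq_empty_iff_forall_notMem.1 hS (ν P') ⟨P', H', h, rfl⟩
  have hSb : BddAbove S := ⟨1, by rintro _ ⟨P, H, -, rfl⟩; exact hν.le_one P⟩
  have hsq : 0 < (δ / 2) ^ 2 := by positivity
  obtain ⟨_, ⟨P, H, hF, rfl⟩, hPmax⟩ := exists_lt_of_lt_csSup hS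
    (show sSup S - (δ / 2) ^ 2 < sSup S by linarith)
  have hFle : ∀ P H, F P H → δ / 2 ≤ ν (H : Set G) := by
    rintro P H ⟨-, -, h3, h4⟩
    linarith [hν.diff_add_inter P C, hν.mono (Set.inter_subset_right : P ∩ C ⊆ C)]
  have hall : ∀ P' H', F P' H' → P' ⊆ P := by
    intro P' H' hF'
    by_contra hsub
    have f1 := hF.1
    have f2 := hF'.1
    have f3 := finite_quotient_inf H H'
    have p1 := hF.2.1.mono (inf_le_left : H ⊓ H' ≤ H)
    have p2 := hF'.2.1.mono (inf_le_right : H ⊓ H' ≤ H')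
    have hinf : (δ / 2) ^ 2 ≤ ν (↑(H ⊓ H') : Set G) := by
      rw [sq]
      exact (mul_le_mul (hFle _ _ hF) (hFle _ _ hF') (by linarith) (hν.nonneg _)).trans
        (hν.mul_le_inf H H')
    have hcon : ∀ Q L, F Q L → Per (H ⊓ H') Q → P ⊆ Q → ¬ Q ⊆ P → False := by
      intro Q L hQ hQ' hPQ hQP
      have h1 := le_csSup hSb (show ν Q ∈ S from ⟨Q, L, hQ, rfl⟩)
      have h2 := hν.per_lt p1 hQ' hPQ hQP
      linarith
    by_cases hPP : P ⊆ P'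
    · exact hcon P' H' hF' p2 hPP hsub
    refine hcon (P ∪ P') (H ⊓ H') ⟨f3, p1.union p2, ?_, ?_⟩ (p1.union p2)
      Set.subset_union_left fun h => hsub (Set.subset_union_right.trans h)
    · rw [Set.union_sdiff_distrib]
      exact hν.null_union hF.2.2.1 hF'.2.2.1
    · rcases hν.union_per hF.2.1 hF'.2.1 hPP hsub with h | h
      · exact hF.2.2.2.trans h
      · exact hF'.2.2.2.trans h
  refine ⟨P, H, hF.1, hF.2.1, hF.2.2.1, fun b hb => hzero _ _ fun hpos => ?_⟩
  obtain ⟨P', H', h1, h2⟩ := hLL P b hb hpos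
  exact h2 (hall P' H' h1)

/-- The union of the cosets of `K` that meet `A` in a set of positive content. -/
def support (μ : Set G → ℝ) (K : AddSubgroup G) (A : Set G) : Set G :=
  {x | 0 < μ (A ∩ fiber K (x : G ⧸ K))}

lemma per_support (μ : Set G → ℝ) (K : AddSubgroup G) (A : Set G) : Per K (support μ K A) := by
  intro x hx k hk
  have : ((x + k : G) : G ⧸ K) = x := by
    rw [eq_comm, QuotientAddGroup.eq]
    simpa using hk
  rw [support, Set.mem_ofPred_eq, this]
  exact hx

namespace IsContent

lemma diff_support (hμ : IsContent μ) (K : AddSubgroup G) [Finite (G ⧸ K)] (A : Set G) :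
    μ (A \ support μ K A) = 0 := by
  refine hμ.null_of_fiber K fun q => ?_
  rcases (hμ.nonneg (A ∩ fiber K q)).lt_or_eq with h | h
  · rw [← hμ.empty]
    congr 1
    refine Set.eq_empty_iff_forall_notMem.2 ?_
    rintro x ⟨⟨-, hx⟩, rfl⟩
    exact hx h
  · exact hμ.null_of_subset (Set.inter_subset_inter_left _ Set.sdiff_subset) h.symm

lemma support_subset (hμ : IsContent μ) {K L : AddSubgroup G} (hKL : K ≤ L) (A : Set G) :
    support μ K A ⊆ A + (L : Set G) := by
  intro x hx
  obtain ⟨a, ha, hax⟩ := hμ.nonempty_of_pos hx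
  exact ⟨a, ha, -a + x, hKL (QuotientAddGroup.eq.1 hax), by dsimp; abel⟩

lemma add_mem_of_support (hν : IsContent ν) (hη : IsContent η) {K : AddSubgroup G}
    {A B P : Set G} (hP : Per K P) (h : ∀ b ∈ B, ν (shift b A \ P) = 0) {x y : G}
    (hx : x ∈ support ν K A) (hy : y ∈ support η K B) : x + y ∈ P := by
  obtain ⟨b, hb, hby⟩ := hη.nonempty_of_pos hy
  have hbk : -b + y ∈ K := QuotientAddGroup.eq.1 hby
  by_contra hcon
  have hle : ν (A ∩ fiber K x) ≤ ν (shift b A \ P) := by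
    rw [← hν.map_shift b]
    refine hν.mono fun z hz => ⟨hz.1, fun hzP => hcon ?_⟩
    have hzx : -(z - b) + x ∈ K := QuotientAddGroup.eq.1 hz.2
    have := hP z hzP _ (K.add_mem hzx hbk)
    rwa [show z + (-(z - b) + x + (-b + y)) = x + y by abel] at this
  have hpos : 0 < ν (A ∩ fiber K x) := hx
  rw [h b hb] at hle
  linarith

/-- In the equality case of Kneser's inequality, `a + B ⊆ C` forces `a ∈ A'`. -/
lemma mem_of_kneser_eq (hη : IsContent η) {L : AddSubgroup G} [Finite (G ⧸ L)]
    {A' B B' C : Set G} (hA' : Per L A') (hB' : Per L B') (hBne : B'.Nonempty)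
    (hstab : stab (A' + B') = L) (heq : η A' + η B' = η (A' + B') + η (L : Set G))
    (hC : η ((A' + B') \ C) = 0) (hB : η (B \ B') = 0) (hlt : η C < η A' + η B) {a : G}
    (ha : ∀ b ∈ B, a + b ∈ C) : a ∈ A' := by
  by_contra haA
  have hfa := per_fiber L (a : G ⧸ L)
  have hdis : Disjoint A' (fiber L (a : G ⧸ L)) :=
    Set.disjoint_left.2 fun x hx hx' => haA (hA'.mem_of_mk_eq hx hx')
  by_cases hall : ∀ y ∈ B', a + y ∈ A' + B'
  · have hsum : (A' ∪ fiber L (a : G ⧸ L)) + B' = A' + B' := by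
      refine Set.Subset.antisymm ?_ (Set.add_subset_add_right Set.subset_union_left)
      rintro _ ⟨x, hx | hx, y, hy, rfl⟩
      · exact ⟨x, hx, y, hy, rfl⟩
      · have h1 : -x + a ∈ L := QuotientAddGroup.eq.1 hx
        have h2 := per_add hB' _ (hall y hy) _ (L.neg_mem h1)
        rwa [show a + y + -(-x + a) = x + y by abel] at h2
    obtain ⟨H, hH, hper, hle⟩ := hη.kneser (hA'.union hfa) hB'
      ⟨a, Or.inr rfl⟩ hBne
    rw [hsum] at hper hle
    obtain rfl : H = L := le_antisymm (hper.le_stab.trans hstab.le) hH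
    rw [hη.union _ _ hdis, hη.fiber_eq] at hle
    linarith [hη.pos_subgroup H]
  · push Not at hall
    obtain ⟨y, hy, hay⟩ := hall
    have hsub : fiber L (y : G ⧸ L) ⊆ B' := fun z hz => hB'.mem_of_mk_eq hy hz.symm
    have h1 : η (A' + B') + η (B ∩ fiber L (y : G ⧸ L)) ≤ η C := by
      rw [← hη.map_shift a (B ∩ _)]
      have h2 : η (A' + B') = η ((A' + B') ∩ C) := by
        linarith [hη.diff_add_inter (A' + B') C]
      rw [h2, ← hη.union]
      · refine hη.mono ?_
        rintro x (hx | hx)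
        · exact hx.2
        · simpa using ha _ hx.1
      · refine Set.disjoint_left.2 fun x hx hx' => hay ?_
        have h3 : -(x - a) + y ∈ L := QuotientAddGroup.eq.1 hx'.2
        have h4 := per_add hB' _ hx.1 _ h3
        rwa [show x + (-(x - a) + y) = a + y by abel] at h4
    have h5 : η B ≤ η (B' \ fiber L (y : G ⧸ L)) + η (B ∩ fiber L (y : G ⧸ L)) := by
      have h6 : η B ≤ η (B' \ fiber L (y : G ⧸ L) ∪ B ∩ fiber L (y : G ⧸ L)) + η (B \ B') := by
        refine hη.le_add fun x hx => ?_
        by_cases hxB : x ∈ B'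
        · by_cases hxy : x ∈ fiber L (y : G ⧸ L)
          · exact Or.inl (Or.inr ⟨hx, hxy⟩)
          · exact Or.inl (Or.inl ⟨hxB, hxy⟩)
        · exact Or.inr ⟨hx, hxB⟩
      linarith [hη.union_le (B' \ fiber L (y : G ⧸ L)) (B ∩ fiber L (y : G ⧸ L))]
    rw [hη.diff_subset hsub, hη.fiber_eq] at h5
    linarith

lemma eq_of_lt_of_le (hμ : IsContent μ) {L : AddSubgroup G} [Finite (G ⧸ L)] {A B C : Set G}
    (hA : Per L A) (hB : Per L B) (hC : Per L C) (hlt : μ C < μ A + μ B)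
    (hle : μ A + μ B ≤ μ C + μ (L : Set G)) : μ A + μ B = μ C + μ (L : Set G) := by
  rw [hμ.per_eq_cosetCount hA, hμ.per_eq_cosetCount hB, hμ.per_eq_cosetCount hC] at hlt hle ⊢
  have h0 := hμ.pos_subgroup L
  have h1 : (cosetCount L C : ℝ) < cosetCount L A + cosetCount L B := by
    refine lt_of_mul_lt_mul_right ?_ h0.le
    rwa [add_mul]
  have h2 : cosetCount L C + 1 ≤ cosetCount L A + cosetCount L B := by exact_mod_cast h1
  have h3 : (cosetCount L C + 1 : ℝ) ≤ cosetCount L A + cosetCount L B := by exact_mod_cast h2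
  have h4 := mul_le_mul_of_nonneg_right h3 h0.le
  rw [add_mul, add_mul, one_mul] at h4
  exact le_antisymm hle h4

lemma le_of_diff_null (hμ : IsContent μ) {S T : Set G} (h : μ (S \ T) = 0) : μ S ≤ μ T := by
  linarith [hμ.diff_add_inter S T, hμ.mono (Set.inter_subset_right : S ∩ T ⊆ T)]

/-- The structure of `A + B` when `max (ν (A + B)) (η (A + B)) < ν A + η B`. -/
lemma exists_subgroup_of_lt (hν : IsContent ν) (hη : IsContent η) (hνη : Mixes ν η)
    (hην : Mixes η ν) (hνν : Mixes ν ν) (hηη : Mixes η η) {A B : Set G} (hA : A.Nonempty)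
    (hB : B.Nonempty) (hlt : ν (A + B) < ν A + η B) (hlt' : η (A + B) < ν A + η B) :
    ∃ L : AddSubgroup G, Finite (G ⧸ L) ∧ A + B ⊆ A + B + (L : Set G) ∧
      ν ((A + B + (L : Set G)) \ (A + B)) = 0 ∧ η ((A + B + (L : Set G)) \ (A + B)) = 0 ∧
      stab (A + B + (L : Set G)) = L ∧
      ν (A + B + (L : Set G)) = ν (A + (L : Set G)) + ν (B + (L : Set G)) - ν (L : Set G) := by
  have sub1 : ∀ b ∈ B, shift b A ⊆ A + B := fun b hb x hx => ⟨_, hx, b, hb, by simp⟩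
  have sub2 : ∀ a ∈ A, shift a B ⊆ A + B := fun a ha x hx => ⟨a, ha, _, hx, by simp⟩
  have hAB : ∀ b ∈ B, ν (shift b A \ (A + B)) = 0 := fun b hb => by
    rw [Set.sdiff_eq_empty.2 (sub1 b hb), hν.empty]
  have hBA : ∀ a ∈ A, η (shift a B \ (A + B)) = 0 := fun a ha => by
    rw [Set.sdiff_eq_empty.2 (sub2 a ha), hη.empty]
  have hAle : ν A ≤ ν (A + B) := by
    obtain ⟨b, hb⟩ := hB
    rw [← hν.map_shift b A]
    exact hν.mono (sub1 b hb)
  have hBle : η B ≤ η (A + B) := by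
    obtain ⟨a, ha⟩ := hA
    rw [← hη.map_shift a B]
    exact hη.mono (sub2 a ha)
  obtain ⟨P, K, hK, hPK, hP, hPA⟩ := hν.exists_per_null hη hνη hνν hηη hAB hlt
  obtain ⟨P', K', hK', hPK', hP', hPB⟩ := hη.exists_per_null hν hην hηη hνν hBA
    (by rwa [add_comm (η B)])
  have hfin := finite_quotient_inf K K'
  set A₀ := support ν (K ⊓ K') A with hA₀
  set B₀ := support η (K ⊓ K') B with hB₀
  have pA₀ : Per (K ⊓ K') A₀ := per_support _ _ _
  have pB₀ : Per (K ⊓ K') B₀ := per_support _ _ _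
  have nA₀ : ν (A \ A₀) = 0 := hν.diff_support _ _
  have nB₀ : η (B \ B₀) = 0 := hη.diff_support _ _
  have leA₀ := hν.le_of_diff_null nA₀
  have leB₀ := hη.le_of_diff_null nB₀
  have A₀ne : A₀.Nonempty := hν.nonempty_of_pos (by linarith)
  have B₀ne : B₀.Nonempty := hη.nonempty_of_pos (by linarith)
  have hCP : A₀ + B₀ ⊆ P := by
    rintro _ ⟨x, hx, y, hy, rfl⟩
    exact hν.add_mem_of_support hη (hPK.mono inf_le_left) hPA hx hy
  have hCP' : A₀ + B₀ ⊆ P' := by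
    rintro _ ⟨x, hx, y, hy, rfl⟩
    change x + y ∈ P'
    rw [add_comm x y]
    exact hη.add_mem_of_support hν (hPK'.mono inf_le_right) hPB hy hx
  obtain ⟨L, hL⟩ : ∃ L, L = stab (A₀ + B₀) := ⟨_, rfl⟩
  have hKL : K ⊓ K' ≤ L := hL ▸ (per_add pB₀).le_stab
  have hfinL : Finite (G ⧸ L) := finite_quotient_of_le hKL
  have pC₀ : Per L (A₀ + B₀) := hL ▸ per_stab _
  have coeL : (L : Set G) + L = L := by
    refine Set.Subset.antisymm ?_ fun x hx => ⟨x, hx, 0, L.zero_mem, add_zero x⟩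
    rintro _ ⟨x, hx, y, hy, rfl⟩
    exact L.add_mem hx hy
  have subL : ∀ S : Set G, S ⊆ S + (L : Set G) := fun S x hx =>
    ⟨x, hx, 0, L.zero_mem, add_zero x⟩
  have hsum : (A₀ + (L : Set G)) + (B₀ + (L : Set G)) = A₀ + B₀ := by
    rw [add_add_add_comm, coeL]
    refine Set.Subset.antisymm ?_ (subL _)
    rintro _ ⟨x, hx, y, hy, rfl⟩
    exact pC₀ x hx y hy
  obtain ⟨A₁, hA₁⟩ : ∃ A₁, A₁ = A₀ + (L : Set G) := ⟨_, rfl⟩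
  obtain ⟨B₁, hB₁⟩ : ∃ B₁, B₁ = B₀ + (L : Set G) := ⟨_, rfl⟩
  rw [← hA₁, ← hB₁] at hsum
  have pA₁ : Per L A₁ := hA₁ ▸ per_add_coe L A₀
  have pB₁ : Per L B₁ := hB₁ ▸ per_add_coe L B₀
  have subA : A₀ ⊆ A₁ := hA₁ ▸ subL A₀
  have subB : B₀ ⊆ B₁ := hB₁ ▸ subL B₀
  have A₁ne := A₀ne.mono subA
  have B₁ne := B₀ne.mono subB
  rw [← hsum] at hCP hCP' pC₀ hL
  have nC : ν ((A₁ + B₁) \ (A + B)) = 0 :=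
    hν.null_of_subset (Set.sdiff_subset_sdiff_left hCP) hP
  have nC' : η ((A₁ + B₁) \ (A + B)) = 0 :=
    hη.null_of_subset (Set.sdiff_subset_sdiff_left hCP') hP'
  have nA : ν (A \ A₁) = 0 := hν.null_of_subset (Set.sdiff_subset_sdiff_right subA) nA₀
  have nB : η (B \ B₁) = 0 := hη.null_of_subset (Set.sdiff_subset_sdiff_right subB) nB₀
  have leA := hν.le_of_diff_null nA
  have leB := hη.le_of_diff_null nB
  have cA := hν.per_congr hη pA₁
  have cB := hν.per_congr hη pB₁
  have cC := hν.per_congr hη pC₀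
  have cL := hν.subgroup_eq hη L
  have heq : ν A₁ + ν B₁ = ν (A₁ + B₁) + ν (L : Set G) := by
    refine hν.eq_of_lt_of_le pA₁ pB₁ pC₀ (by linarith [hν.le_of_diff_null nC]) ?_
    obtain ⟨H, hH, hper, hle⟩ := hν.kneser pA₁ pB₁ A₁ne B₁ne
    obtain rfl : H = L := le_antisymm (hper.le_stab.trans hL.ge) hH
    exact hle
  have hAA : A ⊆ A₁ := fun a ha =>
    hη.mem_of_kneser_eq (C := A + B) pA₁ pB₁ B₁ne hL.symm (by linarith) nC' nB (by linarith)
      fun b hb => Set.add_mem_add ha hb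
  have hBB : B ⊆ B₁ := fun b hb =>
    hν.mem_of_kneser_eq (C := A + B) pB₁ pA₁ A₁ne (by rw [add_comm, hL])
      (by rw [add_comm B₁ A₁]; linarith)
      (by rw [add_comm B₁ A₁]; exact nC) nA (by linarith)
      fun a ha => ⟨a, ha, b, hb, add_comm a b⟩
  have eA : A + (L : Set G) = A₁ := by
    refine Set.Subset.antisymm ?_ ?_
    · rintro _ ⟨a, ha, l, hl, rfl⟩
      exact pA₁ a (hAA ha) l hl
    · rw [hA₁]
      refine (Set.add_subset_add_right (hν.support_subset hKL A)).trans ?_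
      rw [add_assoc, coeL]
  have eB : B + (L : Set G) = B₁ := by
    refine Set.Subset.antisymm ?_ ?_
    · rintro _ ⟨a, ha, l, hl, rfl⟩
      exact pB₁ a (hBB ha) l hl
    · rw [hB₁]
      refine (Set.add_subset_add_right (hη.support_subset hKL B)).trans ?_
      rw [add_assoc, coeL]
  have eC : A + B + (L : Set G) = A₁ + B₁ := by
    rw [← eA, ← eB, add_add_add_comm, coeL]
  refine ⟨L, hfinL, subL _, ?_, ?_, ?_, ?_⟩
  · rwa [eC]
  · rwa [eC]
  · rw [eC, hL]
  · rw [eC, eA, eB]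
    linarith

lemma subgroup_unique (hν : IsContent ν) (hη : IsContent η) {K L : AddSubgroup G}
    [Finite (G ⧸ K)] [Finite (G ⧸ L)] {C : Set G} (hK : stab (C + (K : Set G)) = K)
    (hL : stab (C + (L : Set G)) = L) (nK : ν ((C + (K : Set G)) \ C) = 0)
    (nL : η ((C + (L : Set G)) \ C) = 0) : K = L := by
  have hfin := finite_quotient_inf K L
  have key : ∀ {μ : Set G → ℝ}, IsContent μ → ∀ {H : AddSubgroup G}, K ⊓ L ≤ H →
      μ ((C + (H : Set G)) \ C) = 0 → C + (H : Set G) = C + (↑(K ⊓ L) : Set G) := by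
    intro μ hμ H hH hn
    refine Set.Subset.antisymm ?_ (Set.add_subset_add_left hH)
    by_contra hsub
    have h1 := hμ.per_lt (per_add_coe (K ⊓ L) C) ((per_add_coe H C).mono hH)
      (Set.add_subset_add_left hH) hsub
    have h2 : μ C ≤ μ (C + (↑(K ⊓ L) : Set G)) :=
      hμ.mono fun x hx => ⟨x, hx, 0, (K ⊓ L).zero_mem, add_zero x⟩
    linarith [hμ.le_of_diff_null hn, hμ.pos_subgroup (K ⊓ L)]
  rw [← hK, ← hL, key hν inf_le_left nK, key hη inf_le_right nL]

end IsContent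

lemma coe_eq_stab_iff (K : AddSubgroup G) (X : Set G) :
    (K : Set G) = {g : G | X + {g} = X} ↔ stab X = K := by
  have h : ((stab X : AddSubgroup G) : Set G) = {g : G | X + {g} = X} := by
    ext g
    rw [SetLike.mem_coe, Set.mem_ofPred_eq, mem_stab, Set.ext_iff]
    simp only [Set.add_singleton, Set.image_add_right, Set.mem_preimage]
    constructor
    · intro h x
      simpa using (h (x + -g)).symm
    · intro h x
      simpa using (h (x + g)).symm
  rw [← h, SetLike.coe_set_eq, eq_comm]

end Pairs

theorem two_means_kneser (A B : Set Γ) (hA : A.Nonempty) (hB : B.Nonempty) :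
    ∃ K : AddSubgroup Γ, TwoMeansProp Γ A B K ∧
      ((∃ ν η : BoundedContinuousFunction Γ ℝ →ₗ[ℝ] ℝ,
          IsExtremeInvariantMean Γ ν ∧ IsExtremeInvariantMean Γ η ∧
          max (mVal Γ ν (A + B)) (mVal Γ η (A + B)) < mVal Γ ν A + mVal Γ η B) →
        ∀ K' : AddSubgroup Γ, TwoMeansProp Γ A B K' → K' = K) := by
  by_cases hex : ∃ ν η : BoundedContinuousFunction Γ ℝ →ₗ[ℝ] ℝ,
      IsExtremeInvariantMean Γ ν ∧ IsExtremeInvariantMean Γ η ∧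
      max (mVal Γ ν (A + B)) (mVal Γ η (A + B)) < mVal Γ ν A + mVal Γ η B
  swap
  · exact ⟨⊤, ⟨inferInstance, fun ν η hν hη hlt => absurd ⟨ν, η, hν, hη, hlt⟩ hex⟩,
      fun h => absurd h hex⟩
  obtain ⟨ν, η, hν, hη, hlt⟩ := hex
  have hpair : ∀ ν η : BoundedContinuousFunction Γ ℝ →ₗ[ℝ] ℝ,
      IsExtremeInvariantMean Γ ν → IsExtremeInvariantMean Γ η →
      max (mVal Γ ν (A + B)) (mVal Γ η (A + B)) < mVal Γ ν A + mVal Γ η B → _ :=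
    fun ν η hν hη hlt => hν.1.isContent.exists_subgroup_of_lt hη.1.isContent (hν.mixes hη.1)
      (hη.mixes hν.1) (hν.mixes hν.1) (hη.mixes hη.1) hA hB (max_lt_iff.1 hlt).1
      (max_lt_iff.1 hlt).2
  have hdiff : ∀ L : AddSubgroup Γ,
      symmDiff (A + B) (A + B + (L : Set Γ)) = (A + B + (L : Set Γ)) \ (A + B) := fun L =>
    symmDiff_of_le (show A + B ⊆ A + B + (L : Set Γ) from
      fun x hx => ⟨x, hx, 0, L.zero_mem, add_zero x⟩)
  obtain ⟨K, hKfin, -, nK, -, hK, -⟩ := hpair ν η hν hη hlt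
  refine ⟨K, ⟨AddSubgroup.finiteIndex_iff_finite_quotient.2 hKfin, fun ν' η' hν' hη' hlt' => ?_⟩,
    fun _ K' hK' => ?_⟩
  · obtain ⟨L, hLfin, -, nL, nL', hL, heq⟩ := hpair ν' η' hν' hη' hlt'
    obtain rfl := hν.1.isContent.subgroup_unique hν'.1.isContent hK hL nK nL
    rw [hdiff]
    exact ⟨nL, nL', (coe_eq_stab_iff _ _).2 hL, heq⟩
  · obtain ⟨nK', -, hstab, -⟩ := hK'.2 ν η hν hη hlt
    rw [hdiff] at nK'
    have := AddSubgroup.finiteIndex_iff_finite_quotient.1 hK'.1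
    exact hν.1.isContent.subgroup_unique hν.1.isContent ((coe_eq_stab_iff _ _).1 hstab) hK nK' nK

end SumsetMeans
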